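/- arXiv:1306.1787 — 2 statements merged into one kernel-verified Lean document; each statement's English description precedes it below -/
import Mathlib

section
/- Let X be a set of variables with ordered partition π = (X_1,…,X_n), where each X_i = {x_{i,1} < x_{i,2} < …} is linearly ordered (order type at most ω), and for each i let e_i = (e_{i,1}, e_{i,2}, …) with each e_{i,j} ∈ ℙ ∪ {∞}. Let (M, π) be a finite colored multicomplex of type a ∈ ℙ^n in M_π(e_1,…,e_n), and let t ∈ [n]. If e_{t,1} ≥ e_{t,2} ≥ ⋯, then C_t(M) is a multicomplex, i.e. C_t(M) is nonempty and closed under divisibility. -/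
open Finset

/-- Monomials in the variables `x_{i,j}` (`i : Fin n` a color, `j : ℕ` a position
within the `i`-th linearly ordered block), as finitely supported exponent vectors. -/
abbrev MCMon (n : ℕ) : Type := (Fin n × ℕ) →₀ ℕ

/-- Total degree of a monomial. -/
def totalDeg {n : ℕ} (m : MCMon n) : ℕ := ∑ v ∈ m.support, m v

/-- Degree of the restriction of `m` to the variables of color `t`. -/
def degOn {n : ℕ} (t : Fin n) (m : MCMon n) : ℕ :=
  ∑ v ∈ m.support, if v.1 = t then m v else 0

/-- `M` is a multicomplex: a nonempty set of monomials closed under divisibility. -/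
def IsMulticomplex {n : ℕ} (M : Set (MCMon n)) : Prop :=
  M.Nonempty ∧ ∀ m ∈ M, ∀ m' : MCMon n, (∀ v, m' v ≤ m v) → m' ∈ M

/-- `m` is a member of `𝓜_π(e₁,…,eₙ)`: each variable `x_{i,j}` occurring in `m`
exists (i.e. `j ∈ S i`) and the exponents respect the bounds `e`. -/
def InBounds {n : ℕ} (S : Fin n → Set ℕ) (e : Fin n → ℕ → ℕ∞) (m : MCMon n) : Prop :=
  ∀ (i : Fin n) (j : ℕ), m (i, j) ≠ 0 → j ∈ S i ∧ (m (i, j) : ℕ∞) ≤ e i j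

/-- `(M, π)` is a colored multicomplex of type `a`. -/
def IsColoredType {n : ℕ} (a : Fin n → ℕ) (M : Set (MCMon n)) : Prop :=
  ∀ m ∈ M, ∀ i, degOn i m ≤ a i

/-- `m` and `p` have the same restriction to the variables of colors other than `t`. -/
def agreeAway {n : ℕ} (t : Fin n) (m p : MCMon n) : Prop :=
  ∀ v : Fin n × ℕ, v.1 ≠ t → m v = p v

/-- `𝓜^d_{X_t}(e_t)`: the monomials of degree `d` in the variables of color `t`,
within the bounds `e`. -/
def ColorMon {n : ℕ} (S : Fin n → Set ℕ) (e : Fin n → ℕ → ℕ∞) (t : Fin n) (d : ℕ) :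
    Set (MCMon n) :=
  {q | (∀ v ∈ q.support, v.1 = t) ∧ InBounds S e q ∧ totalDeg q = d}

/-- The color-`t` part of `q` is lexicographically at most the color-`t` part of
`p`: either they are equal, or `q` is strictly smaller at the largest position
where they differ. -/
def lexLePart {n : ℕ} (t : Fin n) (q p : MCMon n) : Prop :=
  (∀ j : ℕ, q (t, j) = p (t, j)) ∨
    ∃ j : ℕ, q (t, j) < p (t, j) ∧ ∀ k : ℕ, j < k → q (t, k) = p (t, k)

/-- The color-`t` part of `p` is a legitimate monomial in the variables of color
`t`, within bounds. -/
def colorPartOk {n : ℕ} (S : Fin n → Set ℕ) (e : Fin n → ℕ → ℕ∞) (t : Fin n)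
    (p : MCMon n) : Prop :=
  ∀ j : ℕ, p (t, j) ≠ 0 → j ∈ S t ∧ (p (t, j) : ℕ∞) ≤ e t j

/-- The color compression operation `C_t`: `p ∈ C_t(M)` iff the restriction of `p`
away from color `t` is the restriction `m̃` of some member of `M`, and the color-`t`
part of `p` lies in the lexicographic initial segment `I^{d;e_t}_{X_t}(f_d(m̃))` of
`𝓜^d_{X_t}(e_t)` (where `d = degOn t p`); membership in this initial segment is
expressed by saying that the number of monomials of `𝓜^d_{X_t}(e_t)` which are
lexicographically at most the color-`t` part of `p` is at most
`f_d(m̃) = #{m ∈ M : m agrees with p away from t, degOn t m = d}`. -/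
noncomputable def compressOp {n : ℕ} (S : Fin n → Set ℕ) (e : Fin n → ℕ → ℕ∞)
    (M : Set (MCMon n)) (t : Fin n) : Set (MCMon n) :=
  {p | (∃ m ∈ M, agreeAway t m p) ∧ colorPartOk S e t p ∧
    {q | q ∈ ColorMon S e t (degOn t p) ∧ lexLePart t q p}.ncard ≤
      {m | m ∈ M ∧ agreeAway t m p ∧ degOn t m = degOn t p}.ncard}

namespace ClementsLindstrom

set_option linter.unusedSectionVars false

section InitialSegments

variable {β α : Type*} [DecidableEq β] [LinearOrder α]

/-- `I` is an initial segment of the finite set `L`, ordered by means of the key `κ`. -/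
def IsInit (κ : β → α) (L I : Finset β) : Prop :=
  I ⊆ L ∧ ∀ y ∈ I, ∀ x ∈ L, κ x ≤ κ y → x ∈ I

variable {κ : β → α} {L I J A : Finset β}

theorem IsInit.subset_or_subset (hI : IsInit κ L I) (hJ : IsInit κ L J) : I ⊆ J ∨ J ⊆ I := by
  by_contra! h
  obtain ⟨⟨x, hx, hxJ⟩, ⟨y, hy, hyI⟩⟩ := And.imp Finset.not_subset.1 Finset.not_subset.1 h
  rcases le_total (κ x) (κ y) with h | h
  · exact hxJ (hJ.2 y hy x (hI.1 hx) h)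
  · exact hyI (hI.2 x hx y (hJ.1 hy) h)

theorem exists_isInit_card (hκ : Function.Injective κ) (L : Finset β) :
    ∀ N ≤ #L, ∃ I, IsInit κ L I ∧ #I = N := by
  intro N
  induction N with
  | zero => exact fun _ => ⟨∅, ⟨by simp, by simp⟩, rfl⟩
  | succ N ih =>
    intro hN
    obtain ⟨I, hI, hc⟩ := ih (by omega)
    have hne : (L \ I).Nonempty := by
      rw [← Finset.card_pos, Finset.card_sdiff_of_subset hI.1]; omega
    obtain ⟨m, hm, hmin⟩ := Finset.exists_min_image _ κ hne
    rw [Finset.mem_sdiff] at hm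
    refine ⟨insert m I, ⟨Finset.insert_subset hm.1 hI.1, ?_⟩, by simp [hm.2, hc]⟩
    intro y hy x hx hxy
    by_cases hxI : x ∈ I
    · exact Finset.mem_insert_of_mem hxI
    · rcases Finset.mem_insert.1 hy with rfl | hy
      · rw [hκ (le_antisymm hxy (hmin x (by simp [hx, hxI])))]
        exact Finset.mem_insert_self _ _
      · exact absurd (hI.2 y hy x hx hxy) hxI

theorem IsInit.sum_lt (hI : IsInit κ L I) (hA : A ⊆ L) (hc : #I = #A) (hne : A ≠ I)
    (g : β → ℕ) (hg : ∀ x ∈ L, ∀ y ∈ L, κ x < κ y → g x < g y) :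
    ∑ x ∈ I, g x < ∑ x ∈ A, g x := by
  have hcard : #(I \ A) = #(A \ I) := by
    have h1 := Finset.card_sdiff_add_card_inter I A
    have h2 := Finset.card_sdiff_add_card_inter A I
    rw [Finset.inter_comm] at h2
    omega
  have hlt : ∀ x ∈ I \ A, ∀ y ∈ A \ I, g x < g y := by
    intro x hx y hy
    rw [Finset.mem_sdiff] at hx hy
    refine hg x (hI.1 hx.1) y (hA hy.1) (lt_of_not_ge fun h => hy.2 (hI.2 x hx.1 y (hA hy.1) h))
  have hne' : (A \ I).Nonempty := by
    rw [Finset.sdiff_nonempty]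
    exact fun h => hne (Finset.eq_of_subset_of_card_le h hc.le)
  have hI' : ∑ x ∈ I, g x = ∑ x ∈ I \ A, g x + ∑ x ∈ I ∩ A, g x := by
    rw [add_comm, Finset.sum_inter_add_sum_sdiff]
  have hA' : ∑ x ∈ A, g x = ∑ x ∈ A \ I, g x + ∑ x ∈ I ∩ A, g x := by
    rw [add_comm, Finset.inter_comm, Finset.sum_inter_add_sum_sdiff]
  rw [hI', hA']
  obtain ⟨e⟩ : Nonempty (↥(I \ A) ≃ ↥(A \ I)) := ⟨Finset.equivOfCardEq hcard⟩
  have : ∑ x ∈ I \ A, g x < ∑ x ∈ A \ I, g x := by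
    rw [← Finset.sum_coe_sort (I \ A), ← Finset.sum_coe_sort (A \ I),
      ← Equiv.sum_comp e]
    obtain ⟨y, hy⟩ := hne'
    exact Finset.sum_lt_sum_of_nonempty ⟨e.symm ⟨y, hy⟩, by simp⟩
      fun x _ => hlt x x.2 (e x) (e x).2
  omega

end InitialSegments

section Box

variable {ι : Type*} [Fintype ι] [LinearOrder ι]

/-- The monomials of degree `d` whose exponents lie between `lo` and `hi`. -/
def level (lo hi : ι → ℕ) (d : ℕ) : Finset (ι → ℕ) :=
  (Finset.Icc lo hi).filter fun x => ∑ i, x i = d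

/-- The monomials of degree `d` obtained from `A` by dividing by a variable, within the box. -/
def shadow (lo hi : ι → ℕ) (d : ℕ) (A : Finset (ι → ℕ)) : Finset (ι → ℕ) :=
  (level lo hi d).filter fun r => ∃ i, r + Pi.single i 1 ∈ A

variable {lo hi : ι → ℕ} {d : ℕ} {A B : Finset (ι → ℕ)} {x y r : ι → ℕ}

theorem mem_level : x ∈ level lo hi d ↔ (∀ i, lo i ≤ x i ∧ x i ≤ hi i) ∧ ∑ i, x i = d := by
  simp [level, Pi.le_def, forall_and]

theorem mem_shadow : r ∈ shadow lo hi d A ↔ r ∈ level lo hi d ∧ ∃ i, r + Pi.single i 1 ∈ A := by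
  simp [shadow]

theorem shadow_mono (h : A ⊆ B) : shadow lo hi d A ⊆ shadow lo hi d B := by
  intro r
  rw [mem_shadow, mem_shadow]
  exact fun ⟨h1, i, hi⟩ => ⟨h1, i, h hi⟩

theorem sum_add_single (x : ι → ℕ) (i : ι) : ∑ j, (x + Pi.single i 1 : ι → ℕ) j = ∑ j, x j + 1 := by
  simp [Finset.sum_add_distrib]

theorem add_single_self (x : ι → ℕ) (i : ι) : (x + Pi.single i 1 : ι → ℕ) i = x i + 1 := by simp

theorem add_single_of_ne (x : ι → ℕ) {i j : ι} (h : j ≠ i) :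
    (x + Pi.single i 1 : ι → ℕ) j = x j := by simp [h]

theorem sub_single_add_single {i : ι} (h : 0 < x i) :
    (x - Pi.single i 1 + Pi.single i 1 : ι → ℕ) = x := by
  funext j
  by_cases hj : j = i
  · subst hj; simp; omega
  · simp [hj]

theorem sub_single_mem_shadow (hA : A ⊆ level lo hi (d + 1)) (hx : x ∈ A) {i : ι}
    (h : lo i < x i) : (x - Pi.single i 1 : ι → ℕ) ∈ shadow lo hi d A := by
  have hb := mem_level.1 (hA hx)
  have hs := sub_single_add_single (x := x) (i := i) (by omega)
  refine mem_shadow.2 ⟨mem_level.2 ⟨fun j => ?_, ?_⟩, i, by rwa [hs]⟩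
  · have := hb.1 j
    by_cases hj : j = i
    · subst hj; simp; omega
    · simpa [hj] using this
  · have := sum_add_single (x - Pi.single i 1) i
    rw [hs] at this
    omega

theorem add_single_mem_level (hr : r ∈ level lo hi d) {i : ι} (h : r i < hi i) :
    (r + Pi.single i 1 : ι → ℕ) ∈ level lo hi (d + 1) := by
  have hb := mem_level.1 hr
  refine mem_level.2 ⟨fun j => ?_, by rw [sum_add_single, hb.2]⟩
  have := hb.1 j
  by_cases hj : j = i
  · subst hj; rw [add_single_self]; omega
  · rwa [add_single_of_ne _ hj]

theorem lt_hi_of_add_single_mem {i : ι} {d : ℕ}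
    (h : (r + Pi.single i 1 : ι → ℕ) ∈ level lo hi d) : r i < hi i := by
  have := (mem_level.1 h).1 i
  rw [add_single_self] at this
  omega

theorem colex_lt_iff : toColex x < toColex y ↔ ∃ p, (∀ j, p < j → x j = y j) ∧ x p < y p := Iff.rfl

theorem colex_lt_add_single (x : ι → ℕ) (i : ι) :
    toColex x < toColex (x + Pi.single i 1 : ι → ℕ) :=
  colex_lt_iff.2 ⟨i, fun j hj => (add_single_of_ne x hj.ne').symm, by rw [add_single_self]; omega⟩

theorem colex_add_single_le_iff (i : ι) :
    toColex (x + Pi.single i 1 : ι → ℕ) ≤ toColex (y + Pi.single i 1 : ι → ℕ) ↔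
      toColex x ≤ toColex y := by
  refine not_lt.symm.trans ((not_congr ?_).trans not_lt)
  refine colex_lt_iff.trans (Iff.trans ?_ colex_lt_iff.symm)
  simp

theorem eq_of_le_of_sum_eq (h : ∀ i, x i ≤ y i) (hs : ∑ i, y i ≤ ∑ i, x i) : x = y := by
  by_contra hne
  obtain ⟨i, hi⟩ := Function.ne_iff.1 hne
  have := Finset.sum_lt_sum (s := Finset.univ) (fun i _ => h i) ⟨i, by simp, lt_of_le_of_ne (h i) hi⟩
  omega

/-- If `l` is the first variable at which `x` is not full, then multiplying `x` by it gives the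
smallest possible multiple above `x`. -/
theorem add_single_le_of_lt {l : ι} (hfull : ∀ j < l, x j = hi j) (hy : ∀ j, y j ≤ hi j)
    (hs : ∑ i, y i = ∑ i, x i + 1) (hxy : toColex x < toColex y) :
    toColex (x + Pi.single l 1 : ι → ℕ) ≤ toColex y := by
  refine not_lt.1 fun hlt => ?_
  obtain ⟨p, hp, hlp⟩ := colex_lt_iff.1 hlt
  rcases lt_trichotomy p l with h | rfl | h
  · have : y = (x + Pi.single l 1 : ι → ℕ) := by
      refine eq_of_le_of_sum_eq (fun j => ?_) (by rw [sum_add_single, hs])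
      rcases lt_or_ge p j with hj | hj
      · exact (hp j hj).le
      · rw [add_single_of_ne _ (hj.trans_lt h).ne, hfull j (hj.trans_lt h)]
        exact hy j
    exact hlt.ne (by rw [this])
  · have : y = x := by
      refine eq_of_le_of_sum_eq (fun j => ?_) (by omega)
      rcases lt_trichotomy p j with hj | rfl | hj
      · rw [hp j hj, add_single_of_ne _ hj.ne']
      · rw [add_single_self] at hlp; omega
      · rw [hfull j hj]; exact hy j
    exact hxy.ne (by rw [this])
  · refine lt_asymm hxy (colex_lt_iff.2 ⟨p, fun j hj => ?_, ?_⟩)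
    · rw [hp j hj, add_single_of_ne _ (h.trans hj).ne']
    · rwa [add_single_of_ne _ h.ne'] at hlp

theorem exists_first_nonfull (h : ∃ i, x i < hi i) (hx : ∀ i, x i ≤ hi i) :
    ∃ l, x l < hi l ∧ ∀ j < l, x j = hi j := by
  obtain ⟨l, hl, hmin⟩ := Finset.exists_minimal (s := Finset.univ.filter fun i => x i < hi i)
    (by obtain ⟨i, hi⟩ := h; exact ⟨i, by simpa using hi⟩)
  refine ⟨l, by simpa using hl, fun j hj => ?_⟩
  by_contra hne
  exact absurd (hmin (by simpa using lt_of_le_of_ne (hx j) hne) hj.le) (not_le.2 hj)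

theorem IsInit.shadow {I : Finset (ι → ℕ)} (hI : IsInit toColex (level lo hi (d + 1)) I) :
    IsInit toColex (level lo hi d) (shadow lo hi d I) := by
  refine ⟨Finset.filter_subset _ _, fun z hz x hx hxz => ?_⟩
  obtain ⟨hz, j, hj⟩ := mem_shadow.1 hz
  have hxb := mem_level.1 hx
  have hyb := mem_level.1 (hI.1 hj)
  obtain ⟨l, hl, hfull⟩ : ∃ l, x l < hi l ∧ ∀ j < l, x j = hi j := by
    refine exists_first_nonfull ?_ fun i => (hxb.1 i).2
    by_contra! h
    have := Finset.sum_le_sum fun i (_ : i ∈ Finset.univ) => (hyb.1 i).2.trans (h i)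
    omega
  refine mem_shadow.2 ⟨hx, l, hI.2 _ hj _ (add_single_mem_level hx hl) ?_⟩
  exact add_single_le_of_lt hfull (fun j => (hyb.1 j).2) (by omega)
    (hxz.trans_lt (colex_lt_add_single z j))

/-! ### Slices -/

theorem level_slice {i : ι} {s : ℕ} (h1 : lo i ≤ s) (h2 : s ≤ hi i) :
    level (Function.update lo i s) (Function.update hi i s) d =
      (level lo hi d).filter fun x => x i = s := by
  ext x
  rw [Finset.mem_filter, mem_level, mem_level]
  constructor
  · rintro ⟨h, hs⟩
    have hi' : x i = s := by have := h i; simp at this; omega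
    refine ⟨⟨fun j => ?_, hs⟩, hi'⟩
    by_cases hj : j = i
    · subst hj; omega
    · simpa [hj] using h j
  · rintro ⟨⟨h, hs⟩, hi'⟩
    refine ⟨fun j => ?_, hs⟩
    by_cases hj : j = i
    · subst hj; simp; omega
    · simpa [hj] using h j

theorem shadow_slice {i : ι} {s : ℕ} (h1 : lo i ≤ s) (h2 : s ≤ hi i) :
    shadow (Function.update lo i s) (Function.update hi i s) d A =
      (shadow lo hi d A).filter fun x => x i = s := by
  ext x
  rw [mem_shadow, level_slice h1 h2, Finset.mem_filter, Finset.mem_filter, mem_shadow]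
  tauto

/-- The Clements–Lindström inequality for the slices of the box in direction `i`. -/
def SliceInequality (lo hi : ι → ℕ) (d : ℕ) (i : ι) : Prop :=
  ∀ s, lo i ≤ s → s ≤ hi i → ∀ A I : Finset (ι → ℕ),
    A ⊆ (level lo hi (d + 1)).filter (fun x => x i = s) →
    IsInit toColex ((level lo hi (d + 1)).filter fun x => x i = s) I → #I = #A →
    #((shadow lo hi d I).filter fun x => x i = s) ≤ #((shadow lo hi d A).filter fun x => x i = s)

theorem exists_compression (i : ι) (H : SliceInequality lo hi d i)
    (hA : A ⊆ level lo hi (d + 1)) :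
    ∃ C, C ⊆ level lo hi (d + 1) ∧
      (∀ s, IsInit toColex ((level lo hi (d + 1)).filter fun x => x i = s)
        (C.filter fun x => x i = s)) ∧
      (∀ s, #(C.filter fun x => x i = s) = #(A.filter fun x => x i = s)) ∧
      #(shadow lo hi d C) ≤ #(shadow lo hi d A) := by
  have hex : ∀ s, ∃ I, IsInit toColex ((level lo hi (d + 1)).filter fun x => x i = s) I ∧
      #I = #(A.filter fun x => x i = s) := fun s =>
    exists_isInit_card toColex.injective _ _ (Finset.card_le_card (Finset.filter_subset_filter _ hA))
  choose I hI hIc using hex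
  have hmemI : ∀ s, ∀ x ∈ I s, x ∈ level lo hi (d + 1) ∧ x i = s := fun s x hx =>
    Finset.mem_filter.1 ((hI s).1 hx)
  let C := (level lo hi (d + 1)).filter fun x => x ∈ I (x i)
  have hCs : ∀ s, (C.filter fun x => x i = s) = I s := by
    intro s
    ext x
    simp only [C, Finset.mem_filter]
    constructor
    · rintro ⟨⟨-, h⟩, rfl⟩; exact h
    · intro h
      have := hmemI s x h
      exact ⟨⟨this.1, by rw [this.2]; exact h⟩, this.2⟩
  refine ⟨C, Finset.filter_subset _ _, fun s => by rw [hCs]; exact hI s,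
    fun s => by rw [hCs]; exact hIc s, ?_⟩
  have hmaps : ∀ B : Finset (ι → ℕ), ∀ x ∈ shadow lo hi d B, x i ∈ Finset.Icc (lo i) (hi i) := by
    intro B x hx
    exact Finset.mem_Icc.2 ((mem_level.1 (mem_shadow.1 hx).1).1 i)
  rw [Finset.card_eq_sum_card_fiberwise (hmaps C), Finset.card_eq_sum_card_fiberwise (hmaps A)]
  refine Finset.sum_le_sum fun s hs => ?_
  obtain ⟨hs1, hs2⟩ := Finset.mem_Icc.1 hs
  let X := (shadow lo hi d (I s)).filter fun x => x i = s
  let Y := (level lo hi d).filter fun r => r i = s ∧ r + Pi.single i 1 ∈ I (s + 1)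
  have hX : IsInit toColex ((level lo hi d).filter fun x => x i = s) X := by
    have := hI s
    rw [← level_slice hs1 hs2] at this
    have := this.shadow
    rwa [level_slice hs1 hs2, shadow_slice hs1 hs2] at this
  have hY : IsInit toColex ((level lo hi d).filter fun x => x i = s) Y := by
    refine ⟨fun r hr => ?_, fun y hy x hx hxy => ?_⟩
    · have := Finset.mem_filter.1 hr
      exact Finset.mem_filter.2 ⟨this.1, this.2.1⟩
    · obtain ⟨hy1, hy2, hy3⟩ := Finset.mem_filter.1 hy
      obtain ⟨hx1, hx2⟩ := Finset.mem_filter.1 hx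
      refine Finset.mem_filter.2 ⟨hx1, hx2, (hI (s + 1)).2 _ hy3 _ ?_ ((colex_add_single_le_iff i).2 hxy)⟩
      refine Finset.mem_filter.2 ⟨add_single_mem_level hx1 ?_, by rw [add_single_self, hx2]⟩
      have := lt_hi_of_add_single_mem (hmemI _ _ hy3).1
      omega
  have hsub : ((shadow lo hi d C).filter fun x => x i = s) ⊆ X ∪ Y := by
    intro r hr
    obtain ⟨hr, hrs⟩ := Finset.mem_filter.1 hr
    obtain ⟨hrl, j, hj⟩ := mem_shadow.1 hr
    have hj := (Finset.mem_filter.1 hj).2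
    rw [Finset.mem_union]
    by_cases hji : i = j
    · subst hji
      rw [add_single_self, hrs] at hj
      exact Or.inr (Finset.mem_filter.2 ⟨hrl, hrs, hj⟩)
    · rw [add_single_of_ne _ hji, hrs] at hj
      exact Or.inl (Finset.mem_filter.2 ⟨mem_shadow.2 ⟨hrl, j, hj⟩, hrs⟩)
  have hXc : #X ≤ #((shadow lo hi d A).filter fun x => x i = s) :=
    (H s hs1 hs2 _ _ (Finset.filter_subset_filter _ hA) (hI s) (hIc s)).trans
      (Finset.card_le_card (Finset.filter_subset_filter _ (shadow_mono (Finset.filter_subset _ _))))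
  have hYc : #Y ≤ #((shadow lo hi d A).filter fun x => x i = s) := by
    calc #Y ≤ #(I (s + 1)) :=
          Finset.card_le_card_of_injOn (fun r => r + Pi.single i 1)
            (fun r hr => (Finset.mem_filter.1 hr).2.2) (fun a _ b _ h => add_right_cancel h)
      _ = #(A.filter fun x => x i = s + 1) := hIc _
      _ ≤ #(((shadow lo hi d A).filter fun x => x i = s).image (fun r => r + Pi.single i 1)) := by
          refine Finset.card_le_card fun x hx => ?_
          obtain ⟨hx, hxs⟩ := Finset.mem_filter.1 hx
          refine Finset.mem_image.2 ⟨x - Pi.single i 1, Finset.mem_filter.2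
            ⟨sub_single_mem_shadow hA hx (by omega), by simp [hxs]⟩,
            sub_single_add_single (by omega)⟩
      _ ≤ _ := Finset.card_image_le
  rcases hX.subset_or_subset hY with h | h
  · exact (Finset.card_le_card (hsub.trans (Finset.union_subset h subset_rfl))).trans hYc
  · exact (Finset.card_le_card (hsub.trans (Finset.union_subset subset_rfl h))).trans hXc

/-! ### Exchanging the largest element for the smallest missing one -/

/-- The variables dividing `x` such that all preceding variables are full in `x`. -/
def corner (lo hi x : ι → ℕ) : Finset ι :=
  Finset.univ.filter fun i => lo i < x i ∧ ∀ j < i, x j = hi j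

theorem mem_corner {i : ι} : i ∈ corner lo hi x ↔ lo i < x i ∧ ∀ j < i, x j = hi j := by
  simp [corner]

theorem colex_add_single_lt {i j : ι} (h : j < i) :
    toColex (r + Pi.single j 1 : ι → ℕ) < toColex (r + Pi.single i 1 : ι → ℕ) :=
  colex_lt_iff.2 ⟨i, fun k hk => by rw [add_single_of_ne _ hk.ne', add_single_of_ne _ (h.trans hk).ne'],
    by rw [add_single_self, add_single_of_ne _ h.ne']; omega⟩

theorem card_shadow_exchange {m q : ι → ℕ} (hA : A ⊆ level lo hi (d + 1)) (hq : q ∈ A)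
    (hmax : ∀ x ∈ A, toColex x ≤ toColex q) (hmq : toColex m < toColex q)
    (hmin : ∀ x ∈ level lo hi (d + 1), toColex x < toColex m → x ∈ A)
    (hc : #(corner lo hi m) ≤ #(corner lo hi q)) :
    #(shadow lo hi d (insert m (A.erase q))) ≤ #(shadow lo hi d A) := by
  have hup : shadow lo hi d (insert m (A.erase q)) ⊆
      shadow lo hi d (A.erase q) ∪ (corner lo hi m).image fun i => (m - Pi.single i 1 : ι → ℕ) := by
    intro r hr
    obtain ⟨hrl, i, hi'⟩ := mem_shadow.1 hr
    rw [Finset.mem_union]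
    rcases Finset.mem_insert.1 hi' with h | h
    · by_cases hic : i ∈ corner lo hi m
      · exact Or.inr (Finset.mem_image.2 ⟨i, hic, by rw [← h]; simp⟩)
      · left
        have hlo : lo i < m i := by
          rw [← h, add_single_self]; have := (mem_level.1 hrl).1 i; omega
        obtain ⟨j, hji, hj⟩ : ∃ j < i, m j ≠ hi j := by
          by_contra! hall
          exact hic (mem_corner.2 ⟨hlo, hall⟩)
        rw [← h, add_single_of_ne _ hji.ne] at hj
        have hlt := colex_add_single_lt (r := r) hji
        rw [h] at hlt
        refine mem_shadow.2 ⟨hrl, j, Finset.mem_erase.2 ⟨?_, hmin _ (add_single_mem_level hrl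
          (lt_of_le_of_ne ((mem_level.1 hrl).1 j).2 hj)) hlt⟩⟩
        rintro heq
        rw [heq] at hlt
        exact lt_asymm hlt hmq
    · exact Or.inl (mem_shadow.2 ⟨hrl, i, h⟩)
  have hlow : shadow lo hi d (A.erase q) ∪
      (corner lo hi q).image (fun i => (q - Pi.single i 1 : ι → ℕ)) ⊆ shadow lo hi d A := by
    refine Finset.union_subset (shadow_mono (Finset.erase_subset _ _)) fun r hr => ?_
    obtain ⟨i, hic, rfl⟩ := Finset.mem_image.1 hr
    exact sub_single_mem_shadow hA hq (mem_corner.1 hic).1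
  have hdisj : Disjoint (shadow lo hi d (A.erase q))
      ((corner lo hi q).image fun i => (q - Pi.single i 1 : ι → ℕ)) := by
    rw [Finset.disjoint_right]
    intro r hr hr'
    obtain ⟨i, hic, rfl⟩ := Finset.mem_image.1 hr
    obtain ⟨hrl, j, hj⟩ := mem_shadow.1 hr'
    obtain ⟨hne, hjA⟩ := Finset.mem_erase.1 hj
    obtain ⟨hlo, hfull⟩ := mem_corner.1 hic
    have hq' := sub_single_add_single (x := q) (i := i) (by omega)
    rcases lt_trichotomy j i with h | rfl | h
    · have := lt_hi_of_add_single_mem (hA hjA)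
      rw [Pi.sub_apply, Pi.single_eq_of_ne h.ne, hfull j h] at this
      omega
    · exact hne hq'
    · have := colex_add_single_lt (r := q - Pi.single i 1) h
      rw [hq'] at this
      exact not_le_of_gt this (hmax _ hjA)
  have hinj : #((corner lo hi q).image fun i => (q - Pi.single i 1 : ι → ℕ)) = #(corner lo hi q) := by
    refine Finset.card_image_of_injOn fun i hi' j _ h => ?_
    by_contra hne
    have := congrFun h i
    have := (mem_corner.1 (Finset.mem_coe.1 hi')).1
    simp [hne] at *
    omega
  calc _ ≤ _ := Finset.card_le_card hup
    _ ≤ _ := Finset.card_union_le _ _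
    _ ≤ #(shadow lo hi d (A.erase q)) + #(corner lo hi q) :=
      Nat.add_le_add_left (Finset.card_image_le.trans hc) _
    _ = _ := by rw [← hinj, ← Finset.card_union_of_disjoint hdisj]
    _ ≤ _ := Finset.card_le_card hlow

/-- Move `δ` units of the exponent of `i` to `j`. -/
def transfer (x : ι → ℕ) (i j : ι) (δ : ℕ) : ι → ℕ :=
  Function.update (Function.update x i (x i - δ)) j (x j + δ)

section Transfer

variable {i j k : ι} {δ : ℕ}

theorem transfer_left (h : i ≠ j) : transfer x i j δ i = x i - δ := by
  simp [transfer, h]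

theorem transfer_right : transfer x i j δ j = x j + δ := by
  simp [transfer]

theorem transfer_of_ne (hi : k ≠ i) (hj : k ≠ j) : transfer x i j δ k = x k := by
  simp [transfer, hi, hj]

theorem sum_transfer (h : i ≠ j) (hδ : δ ≤ x i) : ∑ k, transfer x i j δ k = ∑ k, x k := by
  have : (transfer x i j δ + Pi.single i δ : ι → ℕ) = x + Pi.single j δ := by
    funext k
    by_cases hi : k = i
    · subst hi; simp [transfer_left h, h]; omega
    · by_cases hj : k = j
      · subst hj; simp [transfer_right, hi]
      · simp [transfer_of_ne hi hj, hi, hj]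
  have := congrArg (fun f => ∑ k, f k) this
  simpa [Finset.sum_add_distrib] using this

theorem transfer_mem_level (hx : x ∈ level lo hi d) (h : i ≠ j) (h1 : lo i + δ ≤ x i)
    (h2 : x j + δ ≤ hi j) : transfer x i j δ ∈ level lo hi d := by
  have hb := mem_level.1 hx
  refine mem_level.2 ⟨fun k => ?_, by rw [sum_transfer h (by omega), hb.2]⟩
  have := hb.1 k
  by_cases hi : k = i
  · subst hi; rw [transfer_left h]; omega
  · by_cases hj : k = j
    · subst hj; rw [transfer_right]; omega
    · rwa [transfer_of_ne hi hj]

theorem colex_lt_transfer (h : i < j) (hδ : 0 < δ) : toColex x < toColex (transfer x i j δ) :=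
  colex_lt_iff.2 ⟨j, fun k hk => (transfer_of_ne (h.trans hk).ne' hk.ne').symm,
    by rw [transfer_right]; omega⟩

theorem colex_transfer_lt (h : j < i) (hδ : 0 < δ) (hx : 0 < x i) :
    toColex (transfer x i j δ) < toColex x :=
  colex_lt_iff.2 ⟨i, fun k hk => transfer_of_ne hk.ne' (h.trans hk).ne',
    by rw [transfer_left h.ne']; omega⟩

end Transfer

/-- The variables whose exponent may vary. -/
def free (lo hi : ι → ℕ) : Finset ι := Finset.univ.filter fun i => lo i < hi i

theorem mem_free {i : ι} : i ∈ free lo hi ↔ lo i < hi i := by simp [free]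

theorem eq_of_notMem_free (hx : x ∈ level lo hi d) {i : ι} (h : i ∉ free lo hi) :
    x i = lo i ∧ x i = hi i := by
  have := (mem_level.1 hx).1 i
  rw [mem_free] at h
  omega

/-- A set all of whose slices are initial segments. -/
def IsCompressed (lo hi : ι → ℕ) (d : ℕ) (A : Finset (ι → ℕ)) : Prop :=
  ∀ i ∈ free lo hi, ∀ x ∈ A, ∀ y ∈ level lo hi d, y i = x i → toColex y ≤ toColex x → y ∈ A

theorem IsCompressed.card_corner_le {m q : ι → ℕ} (hC : IsCompressed lo hi d A)
    (hfree : 3 ≤ #(free lo hi)) (hA : A ⊆ level lo hi d) (hqA : q ∈ A) (hm : m ∈ level lo hi d)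
    (hmA : m ∉ A) (hmq : toColex m < toColex q) :
    #(corner lo hi m) ≤ #(corner lo hi q) := by
  have hq := hA hqA
  have hmb := (mem_level.1 hm).1
  have hqb := (mem_level.1 hq).1
  have hdiff : ∀ i ∈ free lo hi, m i ≠ q i := fun i hi' h => hmA (hC i hi' q hqA m hm h hmq.le)
  obtain ⟨k, hk, hklt⟩ := colex_lt_iff.1 hmq
  have hkfree : k ∈ free lo hi := mem_free.2 (by have := hmb k; have := hqb k; omega)
  have hkmax : ∀ i ∈ free lo hi, i ≤ k := fun i hi' => not_lt.1 fun h => hdiff i hi' (hk i h)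
  obtain ⟨f, hf, hfmin⟩ := Finset.exists_min_image (free lo hi) id ⟨k, hkfree⟩
  simp only [id] at hfmin
  have hbelow : ∀ x ∈ level lo hi d, ∀ j < f, x j = hi j := fun x hx j hj =>
    (eq_of_notMem_free hx fun h => not_le_of_gt hj (hfmin j h)).2
  by_contra! hcon
  have hcorner : ∀ i ∈ corner lo hi m, i = f ∨ m f = hi f := by
    intro i hic
    obtain ⟨h1, h2⟩ := mem_corner.1 hic
    have hif := hfmin i (mem_free.2 (h1.trans_le (hmb i).2))
    rcases hif.eq_or_lt with h | h
    · exact Or.inl h.symm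
    · exact Or.inr (h2 f h)
  have hff := mem_free.1 hf
  have hmf : lo f < m f := by
    by_contra hlo
    have : corner lo hi m = ∅ := by
      refine Finset.eq_empty_of_forall_notMem fun i hic => ?_
      rcases hcorner i hic with rfl | h
      · exact hlo (mem_corner.1 hic).1
      · omega
    simp [this] at hcon
  have hext : m f = hi f ∨ q f = lo f := by
    by_contra! h
    have h1 : corner lo hi m ⊆ {f} := fun i hic => by
      rcases hcorner i hic with h' | h'
      · exact Finset.mem_singleton.2 h'
      · exact absurd h' h.1
    have h2 : f ∈ corner lo hi q :=
      mem_corner.2 ⟨by have := hqb f; omega, hbelow q hq⟩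
    have h3 := Finset.card_le_card h1
    have h4 := Finset.card_pos.2 ⟨f, h2⟩
    rw [Finset.card_singleton] at h3
    omega
  have hqf : q f < m f := by
    have := hdiff f hf
    have := hqb f
    have := hmb f
    omega
  have hfk : f < k := lt_of_le_of_ne (hkmax f hf) (by rintro rfl; omega)
  have hltq : ∀ r : ι → ℕ, (∀ j, k < j → r j = m j) → r k < q k → toColex r < toColex q :=
    fun r h1 h2 => colex_lt_iff.2 ⟨k, fun j hj => (h1 j hj).trans (hk j hj), h2⟩
  by_cases hmid : ∃ j, f < j ∧ j < k ∧ m j < q j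
  · obtain ⟨j, hfj, hjk, hj⟩ := hmid
    have hjfree : j ∈ free lo hi := mem_free.2 (by have := hmb j; have := hqb j; omega)
    have hmj := hmb j
    have hqj := hqb j
    have hqf' := hqb f
    have hmf' := hmb f
    rcases hext with hext | hext
    · set δ := min (q j - m j) (m f - q f) with hδ
      have hδpos : 0 < δ := by omega
      have hr : transfer q j f δ ∈ level lo hi d :=
        transfer_mem_level hq hfj.ne' (by omega) (by omega)
      have hrq : toColex (transfer q j f δ) < toColex q :=
        colex_transfer_lt hfj hδpos (by omega)
      have hrA := hC k hkfree q hqA _ hr (transfer_of_ne hjk.ne' hfk.ne') hrq.le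
      have hmr : toColex m < toColex (transfer q j f δ) :=
        colex_lt_iff.2 ⟨k, fun l hl => by
          rw [transfer_of_ne (hjk.trans hl).ne' (hfk.trans hl).ne', hk l hl],
          by rwa [transfer_of_ne hjk.ne' hfk.ne']⟩
      rcases le_total (q j - m j) (m f - q f) with h | h
      · exact hmA (hC j hjfree _ hrA m hm (by rw [transfer_left hfj.ne']; omega) hmr.le)
      · exact hmA (hC f hf _ hrA m hm (by rw [transfer_right]; omega) hmr.le)
    · set δ := min (q j - m j) (m f - q f) with hδ
      have hδpos : 0 < δ := by omega
      have hr : transfer m f j δ ∈ level lo hi d :=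
        transfer_mem_level hm hfj.ne (by omega) (by omega)
      have hmr : toColex m < toColex (transfer m f j δ) := colex_lt_transfer hfj hδpos
      have hrq : toColex (transfer m f j δ) < toColex q :=
        hltq _ (fun l hl => transfer_of_ne (hfk.trans hl).ne' (hjk.trans hl).ne')
          (by rwa [transfer_of_ne hfk.ne' hjk.ne'])
      have hrA : transfer m f j δ ∈ A := by
        rcases le_total (q j - m j) (m f - q f) with h | h
        · exact hC j hjfree q hqA _ hr (by rw [transfer_right]; omega) hrq.le
        · exact hC f hf q hqA _ hr (by rw [transfer_left hfj.ne]; omega) hrq.le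
      exact hmA (hC k hkfree _ hrA m hm (transfer_of_ne hfk.ne' hjk.ne').symm hmr.le)
  · push Not at hmid
    obtain ⟨j, hj⟩ : (((free lo hi).erase f).erase k).Nonempty := by
      rw [← Finset.card_pos]
      have h1 := Finset.pred_card_le_card_erase (s := free lo hi) (a := f)
      have h2 := Finset.pred_card_le_card_erase (s := (free lo hi).erase f) (a := k)
      omega
    simp only [Finset.mem_erase] at hj
    obtain ⟨hjk, hjf, hjfree⟩ := hj
    set δ := m f - q f with hδ
    have hrk : m k + δ < q k := by
      by_contra! hge
      have : q = transfer m f k δ := by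
        refine eq_of_le_of_sum_eq (fun i => ?_) ?_
        · rcases lt_trichotomy i k with hik | rfl | hik
          · rcases lt_trichotomy i f with hif | rfl | hif
            · rw [transfer_of_ne hif.ne hik.ne, hbelow q hq i hif, hbelow m hm i hif]
            · rw [transfer_left hfk.ne]; omega
            · rw [transfer_of_ne hif.ne' hik.ne]
              exact hmid i hif hik
          · rw [transfer_right]; exact hge
          · rw [transfer_of_ne (hfk.trans hik).ne' hik.ne', hk i hik]
        · rw [sum_transfer hfk.ne (by omega), (mem_level.1 hm).2, (mem_level.1 hq).2]
      have := congrFun this j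
      rw [transfer_of_ne hjf hjk] at this
      exact hdiff j hjfree this.symm
    have hr : transfer m f k δ ∈ level lo hi d :=
      transfer_mem_level hm hfk.ne (by have := hqb f; omega) (by have := hqb k; omega)
    have hrq : toColex (transfer m f k δ) < toColex q :=
      hltq _ (fun l hl => transfer_of_ne (hfk.trans hl).ne' hl.ne') (by rwa [transfer_right])
    have hrA := hC f hf q hqA _ hr (by rw [transfer_left hfk.ne]; omega) hrq.le
    exact hmA (hC j hjfree _ hrA m hm (transfer_of_ne hjf hjk).symm
      (colex_lt_transfer hfk (by omega)).le)

/-! ### Boxes with at most two free variables -/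

theorem eq_of_card_free_le_one (hfree : #(free lo hi) ≤ 1) (hx : x ∈ level lo hi d)
    (hy : y ∈ level lo hi d) : x = y := by
  have key : ∀ x ∈ level lo hi d, ∀ y ∈ level lo hi d, (∀ i ∈ free lo hi, x i ≤ y i) → x = y := by
    intro x hx y hy h
    refine eq_of_le_of_sum_eq (fun i => ?_) (by rw [(mem_level.1 hx).2, (mem_level.1 hy).2])
    by_cases hi' : i ∈ free lo hi
    · exact h i hi'
    · rw [(eq_of_notMem_free hx hi').1, (eq_of_notMem_free hy hi').1]
  have hsub := Finset.card_le_one.1 hfree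
  by_cases h : ∀ i ∈ free lo hi, x i ≤ y i
  · exact key x hx y hy h
  · push Not at h
    obtain ⟨i, hi', hlt⟩ := h
    refine (key y hy x hx fun j hj => ?_).symm
    rw [hsub j hj i hi']
    exact hlt.le

theorem add_eq_of_free_eq_pair {a b : ι} (hab : a < b) (hfree : free lo hi = {a, b}) {d' : ℕ}
    (hx : x ∈ level lo hi d) (hy : y ∈ level lo hi d') : d + y a + y b = d' + x a + x b := by
  have hs : ∀ z : ι → ℕ, ∑ i, z i = z a + z b + ∑ i ∈ Finset.univ \ {a, b}, z i := by
    intro z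
    rw [← Finset.sum_pair hab.ne, add_comm, Finset.sum_sdiff (Finset.subset_univ _)]
  have hrest : ∑ i ∈ Finset.univ \ {a, b}, x i = ∑ i ∈ Finset.univ \ {a, b}, y i := by
    refine Finset.sum_congr rfl fun i hi' => ?_
    rw [← hfree] at hi'
    have := (Finset.mem_sdiff.1 hi').2
    rw [(eq_of_notMem_free hx this).1, (eq_of_notMem_free hy this).1]
  have h1 := hs x
  have h2 := hs y
  rw [(mem_level.1 hx).2] at h1
  rw [(mem_level.1 hy).2] at h2
  omega

theorem eq_of_free_eq_pair {a b : ι} (hab : a < b) (hfree : free lo hi = {a, b})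
    (hx : x ∈ level lo hi d) (hy : y ∈ level lo hi d) (h : x a = y a) : x = y := by
  have hsum := add_eq_of_free_eq_pair hab hfree hx hy
  funext i
  by_cases hi' : i ∈ free lo hi
  · rw [hfree, Finset.mem_insert, Finset.mem_singleton] at hi'
    rcases hi' with rfl | rfl <;> omega
  · rw [(eq_of_notMem_free hx hi').1, (eq_of_notMem_free hy hi').1]

theorem card_image_sub_single {a : ι} (h : ∀ x ∈ A, 0 < x a) :
    #(A.image fun x => (x - Pi.single a 1 : ι → ℕ)) = #A := by
  refine Finset.card_image_of_injOn fun x hx y hy hxy => ?_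
  rw [← sub_single_add_single (h x hx), ← sub_single_add_single (h y hy)]
  exact congrArg (· + Pi.single a 1) hxy

theorem card_shadow_le_of_free_eq_pair {a b : ι} (hab : a < b) (hfree : free lo hi = {a, b})
    (hdec : hi b - lo b ≤ hi a - lo a) (hA : A ⊆ level lo hi (d + 1)) {I : Finset (ι → ℕ)}
    (hI : IsInit toColex (level lo hi (d + 1)) I) (hc : #I = #A) :
    #(shadow lo hi d I) ≤ #(shadow lo hi d A) := by
  have ha : lo a < hi a := mem_free.1 (by simp [hfree])
  have hb : lo b < hi b := mem_free.1 (by simp [hfree])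
  set T := (level lo hi d).filter fun r => r a = hi a with hT
  have hTc : #T ≤ 1 := Finset.card_le_one.2 fun x hx y hy => by
    rw [hT, Finset.mem_filter] at hx hy
    exact eq_of_free_eq_pair hab hfree hx.1 hy.1 (hx.2.trans hy.2.symm)
  have hup : #(shadow lo hi d I) ≤ #I + #T := by
    refine (Finset.card_le_card (t := I.image (fun x => (x - Pi.single a 1 : ι → ℕ)) ∪ T) ?_).trans
      ((Finset.card_union_le _ _).trans (Nat.add_le_add_right Finset.card_image_le _))
    intro r hr
    obtain ⟨hrl, i, hi'⟩ := mem_shadow.1 hr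
    have hrb := (mem_level.1 hrl).1
    rw [Finset.mem_union]
    rcases (hrb a).2.eq_or_lt with h | h
    · exact Or.inr (Finset.mem_filter.2 ⟨hrl, h⟩)
    · refine Or.inl (Finset.mem_image.2 ⟨r + Pi.single a 1, ?_, by simp⟩)
      have hif : i ∈ free lo hi :=
        mem_free.2 ((hrb i).1.trans_lt (lt_hi_of_add_single_mem (hI.1 hi')))
      rw [hfree, Finset.mem_insert, Finset.mem_singleton] at hif
      rcases hif with rfl | rfl
      · exact hi'
      · exact hI.2 _ hi' _ (add_single_mem_level hrl h) (colex_add_single_lt hab).le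
  rcases T.eq_empty_or_nonempty with hTe | ⟨r, hr⟩
  · rw [hTe, Finset.card_empty, add_zero, hc] at hup
    by_cases hz : ∀ x ∈ A, lo a < x a
    · refine hup.trans ?_
      rw [← card_image_sub_single (a := a) fun x hx => (Nat.zero_le _).trans_lt (hz x hx)]
      refine Finset.card_le_card fun r hr => ?_
      obtain ⟨x, hx, rfl⟩ := Finset.mem_image.1 hr
      exact sub_single_mem_shadow hA hx (hz x hx)
    · push Not at hz
      obtain ⟨z, hz, hza⟩ := hz
      have hzl := hA hz
      have hzb := (mem_level.1 hzl).1
      have hunique : ∀ x ∈ level lo hi (d + 1), x ≠ z → lo a < x a := by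
        intro x hx hne
        refine lt_of_le_of_ne ((mem_level.1 hx).1 a).1 fun h => hne ?_
        exact eq_of_free_eq_pair hab hfree hx hzl (by have := hzb a; omega)
      rcases (level lo hi (d + 1) \ A).eq_empty_or_nonempty with hLA | hne
      · have hAL : A = level lo hi (d + 1) := hA.antisymm (Finset.sdiff_eq_empty_iff_subset.1 hLA)
        rw [Finset.eq_of_subset_of_card_le hI.1 (by rw [hc, hAL]), hAL]
      · obtain ⟨y, hy, hymax⟩ := Finset.exists_max_image _ toColex hne
        rw [Finset.mem_sdiff] at hy
        have hya : lo a < y a := hunique y hy.1 (by rintro rfl; exact hy.2 hz)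
        have hsum := add_eq_of_free_eq_pair hab hfree hy.1 hzl
        have hyb : y b < hi b := by have := hzb b; omega
        have hy' : transfer y a b 1 ∈ A := by
          by_contra hnot
          have := hymax _ (Finset.mem_sdiff.2
            ⟨transfer_mem_level hy.1 hab.ne (by omega) (by omega), hnot⟩)
          exact not_le_of_gt (colex_lt_transfer hab one_pos) this
        have hyA : (y - Pi.single a 1 : ι → ℕ) ∈ shadow lo hi d A := by
          have : (transfer y a b 1 - Pi.single b 1 : ι → ℕ) = y - Pi.single a 1 := by
            funext i
            by_cases hia : i = a
            · subst hia; simp [transfer_left hab.ne, hab.ne]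
            · by_cases hib : i = b
              · subst hib; simp [transfer_right, hia]
              · simp [transfer_of_ne hia hib, hia, hib]
          rw [← this]
          refine sub_single_mem_shadow hA hy' ?_
          rw [transfer_right]
          have := (mem_level.1 hy.1).1 b
          omega
        have hcard : #(insert y (A.erase z)) = #A := by
          rw [Finset.card_insert_of_notMem (by simp [hy.2]), Finset.card_erase_add_one hz]
        have hpos : ∀ x ∈ insert y (A.erase z), lo a < x a := by
          intro x hx
          rcases Finset.mem_insert.1 hx with rfl | hx
          · exact hya
          · exact hunique x (hA (Finset.mem_of_mem_erase hx)) (Finset.ne_of_mem_erase hx)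
        rw [← hcard, ← card_image_sub_single (a := a)
          fun x hx => (Nat.zero_le _).trans_lt (hpos x hx)] at hup
        refine hup.trans (Finset.card_le_card fun r hr => ?_)
        obtain ⟨x, hx, rfl⟩ := Finset.mem_image.1 hr
        rcases Finset.mem_insert.1 hx with rfl | hx'
        · exact hyA
        · exact sub_single_mem_shadow hA (Finset.mem_of_mem_erase hx') (hpos x hx)
  · rw [hT, Finset.mem_filter] at hr
    have hrb := (mem_level.1 hr.1).1 b
    have hbounds : ∀ x ∈ level lo hi (d + 1), lo a < x a ∧ lo b < x b := by
      intro x hx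
      have h1 := add_eq_of_free_eq_pair hab hfree hx hr.1
      have h2 := (mem_level.1 hx).1 a
      have h3 := (mem_level.1 hx).1 b
      omega
    rcases A.eq_empty_or_nonempty with rfl | hne
    · rw [Finset.card_empty, Finset.card_eq_zero] at hc
      rw [hc]
    · obtain ⟨y, hy, hymin⟩ := Finset.exists_min_image A (fun x => x b) hne
      have hyb := (hbounds y (hA hy)).2
      have hnot : (y - Pi.single b 1 : ι → ℕ) ∉ A.image fun x => (x - Pi.single a 1 : ι → ℕ) := by
        intro h
        obtain ⟨x, hx, hxy⟩ := Finset.mem_image.1 h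
        have h1 := congrFun hxy b
        have h2 := hymin x hx
        simp [hab.ne'] at h1
        omega
      have hcard : #(insert (y - Pi.single b 1 : ι → ℕ)
          (A.image fun x => (x - Pi.single a 1 : ι → ℕ))) = #A + 1 := by
        rw [Finset.card_insert_of_notMem hnot, card_image_sub_single
          fun x hx => (Nat.zero_le _).trans_lt (hbounds x (hA hx)).1]
      have hlow := Finset.card_le_card (Finset.insert_subset (sub_single_mem_shadow hA hy hyb)
        (Finset.image_subset_iff.2 fun x hx =>
          sub_single_mem_shadow hA hx (hbounds x (hA hx)).1))
      rw [hcard] at hlow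
      omega

/-! ### The Clements–Lindström theorem -/

theorem free_update {i : ι} {s : ℕ} :
    free (Function.update lo i s) (Function.update hi i s) = (free lo hi).erase i := by
  ext j
  rw [Finset.mem_erase, mem_free, mem_free]
  by_cases h : j = i
  · subst h; simp
  · simp [h]

theorem card_shadow_le_of_sliceInequality (hfree : 3 ≤ #(free lo hi))
    (H : ∀ i ∈ free lo hi, SliceInequality lo hi d i) {I : Finset (ι → ℕ)}
    (hI : IsInit toColex (level lo hi (d + 1)) I) :
    ∀ A ⊆ level lo hi (d + 1), #I = #A → #(shadow lo hi d I) ≤ #(shadow lo hi d A) := by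
  classical
  let g : (ι → ℕ) → ℕ := fun x => #((level lo hi (d + 1)).filter fun y => toColex y < toColex x)
  have hg : ∀ x ∈ level lo hi (d + 1), ∀ y ∈ level lo hi (d + 1), toColex x < toColex y →
      g x < g y := by
    intro x hx y _ hxy
    refine Finset.card_lt_card (Finset.ssubset_iff_of_subset ?_ |>.2 ⟨x, ?_, ?_⟩)
    · intro z hz
      rw [Finset.mem_filter] at hz ⊢
      exact ⟨hz.1, hz.2.trans hxy⟩
    · exact Finset.mem_filter.2 ⟨hx, hxy⟩
    · exact fun h => lt_irrefl _ (Finset.mem_filter.1 h).2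
  intro A
  induction hN : ∑ x ∈ A, g x using Nat.strong_induction_on generalizing A with
  | _ N ih =>
  subst hN
  intro hA hc
  by_cases hcomp : IsCompressed lo hi (d + 1) A
  · by_cases hAI : A = I
    · rw [hAI]
    · have hne : ∀ B C : Finset (ι → ℕ), #B = #C → B ≠ C → (B \ C).Nonempty := by
        intro B C hBC hne
        rw [Finset.sdiff_nonempty]
        exact fun h => hne (Finset.eq_of_subset_of_card_le h hBC.ge)
      obtain ⟨x, hx⟩ := hne I A hc (Ne.symm hAI)
      obtain ⟨y, hy⟩ := hne A I hc.symm hAI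
      rw [Finset.mem_sdiff] at hx hy
      obtain ⟨q, hq, hmax⟩ := Finset.exists_max_image A toColex ⟨y, hy.1⟩
      obtain ⟨m, hm, hmin⟩ := Finset.exists_min_image (level lo hi (d + 1) \ A) toColex
        ⟨x, Finset.mem_sdiff.2 ⟨hI.1 hx.1, hx.2⟩⟩
      have hmx := hmin x (Finset.mem_sdiff.2 ⟨hI.1 hx.1, hx.2⟩)
      rw [Finset.mem_sdiff] at hm
      have hxy : toColex x < toColex y := lt_of_not_ge fun h => hy.2 (hI.2 x hx.1 y (hA hy.1) h)
      have hmq : toColex m < toColex q := (hmx.trans_lt hxy).trans_le (hmax y hy.1)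
      have hcorner := hcomp.card_corner_le hfree hA hq hm.1 hm.2 hmq
      have hsh := card_shadow_exchange hA hq hmax hmq
        (fun z hz hzm => by
          by_contra hzA
          exact not_le_of_gt hzm (hmin z (Finset.mem_sdiff.2 ⟨hz, hzA⟩))) hcorner
      have hm' : m ∉ A.erase q := fun h => hm.2 (Finset.mem_of_mem_erase h)
      refine (ih _ ?_ _ rfl (Finset.insert_subset hm.1 ((Finset.erase_subset _ _).trans hA)) ?_).trans
        hsh
      · rw [Finset.sum_insert hm', ← Finset.add_sum_erase A g hq]
        exact Nat.add_lt_add_right (hg m hm.1 q (hA hq) hmq) _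
      · rw [Finset.card_insert_of_notMem hm', Finset.card_erase_add_one hq, hc]
  · unfold IsCompressed at hcomp
    push Not at hcomp
    obtain ⟨i, hi', x, hxA, y, hy, hyx, hle, hyA⟩ := hcomp
    obtain ⟨C, hC, hCinit, hCcard, hCsh⟩ := exists_compression i (H i hi') hA
    have hmaps : ∀ B ⊆ level lo hi (d + 1), ∀ x ∈ B, x i ∈ Finset.range (hi i + 1) :=
      fun B hB x hx => Finset.mem_range.2 (Nat.lt_succ_of_le ((mem_level.1 (hB hx)).1 i).2)
    have hcc : #C = #A := by
      rw [Finset.card_eq_sum_card_fiberwise (hmaps C hC),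
        Finset.card_eq_sum_card_fiberwise (hmaps A hA)]
      exact Finset.sum_congr rfl fun s _ => hCcard s
    refine (ih _ ?_ C rfl hC (hc.trans hcc.symm)).trans hCsh
    rw [← Finset.sum_fiberwise_of_maps_to (hmaps C hC),
      ← Finset.sum_fiberwise_of_maps_to (hmaps A hA)]
    have hslice : ∀ s, (A.filter fun x => x i = s) ≠ (C.filter fun x => x i = s) →
        ∑ x ∈ C.filter (fun x => x i = s), g x < ∑ x ∈ A.filter (fun x => x i = s), g x :=
      fun s hne => (hCinit s).sum_lt (Finset.filter_subset_filter _ hA) (hCcard s) hne g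
        fun x hx y hy => hg x (Finset.mem_filter.1 hx).1 y (Finset.mem_filter.1 hy).1
    refine Finset.sum_lt_sum (fun s _ => ?_) ⟨x i, hmaps A hA x hxA, hslice _ fun heq => ?_⟩
    · by_cases h : (A.filter fun x => x i = s) = (C.filter fun x => x i = s)
      · rw [h]
      · exact (hslice s h).le
    · have hx' : x ∈ C.filter fun z => z i = x i := heq ▸ Finset.mem_filter.2 ⟨hxA, rfl⟩
      have := (hCinit (x i)).2 x hx' y (Finset.mem_filter.2 ⟨hy, hyx⟩) hle
      rw [← heq] at this
      exact hyA (Finset.mem_filter.1 this).1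

/-- **Clements–Lindström theorem**: among all sets of monomials of given degree and size in a box
with weakly decreasing side lengths, initial segments have the smallest shadow. -/
theorem card_shadow_le_of_card_eq (lo hi : ι → ℕ)
    (hdec : ∀ i ∈ free lo hi, ∀ j ∈ free lo hi, i < j → hi j - lo j ≤ hi i - lo i) (d : ℕ)
    {I : Finset (ι → ℕ)} (hI : IsInit toColex (level lo hi (d + 1)) I) (A : Finset (ι → ℕ))
    (hA : A ⊆ level lo hi (d + 1)) (hc : #I = #A) :
    #(shadow lo hi d I) ≤ #(shadow lo hi d A) := by
  induction hk : #(free lo hi) using Nat.strong_induction_on generalizing lo hi d I A with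
  | _ k ih =>
  subst hk
  rcases Nat.lt_or_ge #(free lo hi) 3 with hlt | hge
  · rcases Nat.lt_or_ge #(free lo hi) 2 with hlt' | hge
    · have hone : #(level lo hi (d + 1)) ≤ 1 :=
        Finset.card_le_one.2 fun x hx y hy => eq_of_card_free_le_one (by omega) hx hy
      rcases A.eq_empty_or_nonempty with rfl | ⟨x, hx⟩
      · rw [Finset.card_empty, Finset.card_eq_zero] at hc
        rw [hc]
      · have hpos := Finset.card_pos.2 ⟨x, hx⟩
        rw [Finset.eq_of_subset_of_card_le hI.1 (by omega),
          Finset.eq_of_subset_of_card_le hA (by omega)]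
    · obtain ⟨a, b, hab, hfree⟩ := Finset.card_eq_two.1 (show #(free lo hi) = 2 by omega)
      have ha : a ∈ free lo hi := by simp [hfree]
      have hb : b ∈ free lo hi := by simp [hfree]
      rcases hab.lt_or_gt with h | h
      · exact card_shadow_le_of_free_eq_pair h hfree (hdec a ha b hb h) hA hI hc
      · exact card_shadow_le_of_free_eq_pair h (hfree.trans (Finset.pair_comm a b))
          (hdec b hb a ha h) hA hI hc
  · refine card_shadow_le_of_sliceInequality hge (fun i hi' s hs1 hs2 A I hA hI hc => ?_) hI A hA hc
    rw [← level_slice hs1 hs2] at hA hI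
    rw [← shadow_slice hs1 hs2, ← shadow_slice hs1 hs2]
    refine ih _ ?_ _ _ ?_ d hI A hA hc rfl
    · rw [free_update]
      exact Finset.card_erase_lt_of_mem hi'
    · rw [free_update]
      intro j hj k hk hjk
      rw [Finset.mem_erase] at hj hk
      simpa [hj.1, hk.1] using hdec j hj.2 k hk.2 hjk

theorem card_shadow_le (lo hi : ι → ℕ)
    (hdec : ∀ i ∈ free lo hi, ∀ j ∈ free lo hi, i < j → hi j - lo j ≤ hi i - lo i) (d : ℕ)
    {I : Finset (ι → ℕ)} (hI : IsInit toColex (level lo hi (d + 1)) I) {A : Finset (ι → ℕ)}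
    (hA : A ⊆ level lo hi (d + 1)) (hc : #I ≤ #A) :
    #(shadow lo hi d I) ≤ #(shadow lo hi d A) := by
  obtain ⟨B, hBA, hB⟩ := Finset.exists_subset_card_eq hc
  exact (card_shadow_le_of_card_eq lo hi hdec d hI B (hBA.trans hA) hB.symm).trans
    (Finset.card_le_card (shadow_mono hBA))

end Box

end ClementsLindstrom

section Compression

variable {n : ℕ} {S : Fin n → Set ℕ} {e : Fin n → ℕ → ℕ∞} {M : Set (MCMon n)} {t : Fin n}

open ClementsLindstrom

/-- The exponents of the first `N` variables of color `t`. -/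
def row (t : Fin n) (N : ℕ) (m : MCMon n) : Fin N → ℕ := fun j => m (t, j)

/-- The monomial in the variables of color `t` with prescribed exponents of the first `N`. -/
noncomputable def ofRow (t : Fin n) {N : ℕ} (x : Fin N → ℕ) : MCMon n :=
  Finsupp.onFinset ({t} ×ˢ Finset.range N)
    (fun v => if h : v.1 = t ∧ v.2 < N then x ⟨v.2, h.2⟩ else 0) fun v hv => by
      by_contra h
      refine hv (dif_neg fun h' => h ?_)
      exact Finset.mem_product.2 ⟨Finset.mem_singleton.2 h'.1, Finset.mem_range.2 h'.2⟩

theorem row_ofRow {N : ℕ} (x : Fin N → ℕ) : row t N (ofRow t x) = x := by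
  funext j
  simp [row, ofRow]

theorem ofRow_of_ne {N : ℕ} (x : Fin N → ℕ) {v : Fin n × ℕ} (h : v.1 ≠ t) : ofRow t x v = 0 := by
  simp [ofRow, h]

theorem ofRow_of_le {N : ℕ} (x : Fin N → ℕ) {j : ℕ} (h : N ≤ j) : ofRow t x (t, j) = 0 := by
  simp [ofRow, h]

theorem degOn_eq_sum_row {N : ℕ} {m : MCMon n} (h : ∀ j, N ≤ j → m (t, j) = 0) :
    degOn t m = ∑ j, row t N m j := by
  have hinj : Function.Injective fun j : ℕ => (t, j) := fun _ _ h => (Prod.ext_iff.1 h).2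
  calc degOn t m = ∑ v ∈ m.support.filter fun v => v.1 = t, m v := (Finset.sum_filter _ _).symm
    _ = ∑ v ∈ (Finset.range N).map ⟨_, hinj⟩, m v := by
      refine Finset.sum_subset ?_ ?_
      · rintro ⟨i, j⟩ hv
        rw [Finset.mem_filter, Finsupp.mem_support_iff] at hv
        obtain ⟨hv, rfl⟩ := hv
        refine Finset.mem_map.2 ⟨j, Finset.mem_range.2 ?_, rfl⟩
        by_contra hj
        exact hv (h j (not_lt.1 hj))
      · intro v hv hv'
        obtain ⟨j, -, rfl⟩ := Finset.mem_map.1 hv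
        simpa using hv'
    _ = ∑ j, row t N m j := by
      rw [Finset.sum_map]
      exact (Fin.sum_univ_eq_sum_range (fun j => m (t, j)) N).symm

theorem totalDeg_eq_degOn {q : MCMon n} (h : ∀ v ∈ q.support, v.1 = t) :
    totalDeg q = degOn t q :=
  Finset.sum_congr rfl fun v hv => (if_pos (h v hv)).symm

theorem exists_forall_le_eq_zero (t : Fin n) (m : MCMon n) :
    ∃ N, ∀ j, N ≤ j → m (t, j) = 0 := by
  refine ⟨m.support.sup Prod.snd + 1, fun j hj => ?_⟩
  by_contra h
  have := Finset.le_sup (f := Prod.snd) (Finsupp.mem_support_iff.2 h)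
  dsimp only at this
  omega

theorem degOn_congr {m p : MCMon n} (h : ∀ j, m (t, j) = p (t, j)) : degOn t m = degOn t p := by
  obtain ⟨N, hN⟩ := exists_forall_le_eq_zero t m
  rw [degOn_eq_sum_row hN, degOn_eq_sum_row fun j hj => (h j).symm.trans (hN j hj)]
  exact Finset.sum_congr rfl fun j _ => h j

theorem eq_of_agreeAway {m p : MCMon n} (h : agreeAway t m p) (h' : ∀ j, m (t, j) = p (t, j)) :
    m = p := by
  ext ⟨i, j⟩
  by_cases hi : i = t
  · subst hi
    exact h' j
  · exact h (i, j) hi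

theorem row_injOn {N : ℕ} {m p : MCMon n} (h : agreeAway t m p)
    (hm : ∀ j, N ≤ j → m (t, j) = 0) (hp : ∀ j, N ≤ j → p (t, j) = 0)
    (hr : row t N m = row t N p) : m = p := by
  refine eq_of_agreeAway h fun j => ?_
  rcases lt_or_ge j N with hj | hj
  · exact congrFun hr ⟨j, hj⟩
  · rw [hm j hj, hp j hj]

open Classical in
/-- The exponent bounds of the first `N` variables of color `t`, truncated at `D`. -/
noncomputable def rowBound (S : Fin n → Set ℕ) (e : Fin n → ℕ → ℕ∞) (t : Fin n) (N D : ℕ) :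
    Fin N → ℕ :=
  fun j => if (j : ℕ) ∈ S t then (min (e t j) D).toNat else 0

theorem le_rowBound_iff {N D : ℕ} {j : Fin N} {k : ℕ} (hk : k ≤ D) :
    k ≤ rowBound S e t N D j ↔ (k ≠ 0 → (j : ℕ) ∈ S t ∧ (k : ℕ∞) ≤ e t j) := by
  have hne : min (e t j) (D : ℕ∞) ≠ ⊤ := ne_top_of_le_ne_top (ENat.natCast_ne_top D) (min_le_right _ _)
  unfold rowBound
  split_ifs with h
  · rw [← ENat.natCast_le_natCast, ENat.natCast_toNat hne, le_min_iff]
    refine ⟨fun h' _ => ⟨h, h'.1⟩, fun h' => ⟨?_, by exact_mod_cast hk⟩⟩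
    rcases eq_or_ne k 0 with rfl | h0
    · simp
    · exact (h' h0).2
  · simp [h]

theorem row_mem_level_iff {N D k : ℕ} (hk : k ≤ D) {m : MCMon n}
    (hm : ∀ j, N ≤ j → m (t, j) = 0) :
    row t N m ∈ level 0 (rowBound S e t N D) k ↔ colorPartOk S e t m ∧ degOn t m = k := by
  rw [mem_level, degOn_eq_sum_row hm]
  refine and_congr_left fun hs => ?_
  have hle : ∀ j, row t N m j ≤ D := fun j =>
    ((Finset.single_le_sum (fun _ _ => Nat.zero_le _) (Finset.mem_univ j)).trans hs.le).trans hk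
  refine ⟨fun h j hj => ?_, fun h j => ⟨Nat.zero_le _, (le_rowBound_iff (hle j)).2 (h j)⟩⟩
  have hjN : j < N := by
    by_contra hjN
    exact hj (hm j (not_lt.1 hjN))
  exact (le_rowBound_iff (hle ⟨j, hjN⟩)).1 (h ⟨j, hjN⟩).2 hj

theorem eq_zero_of_lexLePart {N : ℕ} {q p : MCMon n} (h : lexLePart t q p)
    (hp : ∀ j, N ≤ j → p (t, j) = 0) {j : ℕ} (hj : N ≤ j) : q (t, j) = 0 := by
  obtain h | ⟨i, hi, hi'⟩ := h
  · rw [h, hp j hj]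
  · have : i < N := by
      by_contra hN
      rw [hp i (not_lt.1 hN)] at hi
      omega
    rw [hi' j (by omega), hp j hj]

theorem lexLePart_iff {N : ℕ} {q p : MCMon n} (hq : ∀ j, N ≤ j → q (t, j) = 0)
    (hp : ∀ j, N ≤ j → p (t, j) = 0) :
    lexLePart t q p ↔ toColex (row t N q) ≤ toColex (row t N p) := by
  have heq : (∀ j, q (t, j) = p (t, j)) ↔ toColex (row t N q) = toColex (row t N p) := by
    refine ⟨fun h => congrArg toColex (funext fun j => h j), fun h j => ?_⟩
    rcases lt_or_ge j N with hj | hj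
    · exact congrFun (toColex.injective h) ⟨j, hj⟩
    · rw [hq j hj, hp j hj]
  refine Iff.trans ?_ le_iff_eq_or_lt.symm
  refine or_congr heq (Iff.trans ?_ colex_lt_iff.symm)
  constructor
  · rintro ⟨j, hj, hj'⟩
    have hjN : j < N := by
      by_contra hN
      rw [hp j (not_lt.1 hN)] at hj
      omega
    exact ⟨⟨j, hjN⟩, fun k hk => hj' k hk, hj⟩
  · rintro ⟨j, hj', hj⟩
    refine ⟨j, hj, fun k hk => ?_⟩
    rcases lt_or_ge k N with hkN | hkN
    · exact hj' ⟨k, hkN⟩ hk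
    · rw [hq k hkN, hp k hkN]

open Classical in
theorem ncard_lexLePart {N D k : ℕ} (hk : k ≤ D) {p : MCMon n}
    (hp : ∀ j, N ≤ j → p (t, j) = 0) :
    {q | q ∈ ColorMon S e t k ∧ lexLePart t q p}.ncard =
      #((level 0 (rowBound S e t N D) k).filter fun x => toColex x ≤ toColex (row t N p)) := by
  rw [← Set.ncard_coe_finset, ← Set.InjOn.ncard_image (f := row t N)]
  · congr 1
    ext x
    simp only [Set.mem_image, Set.mem_ofPred_eq, Finset.coe_filter]
    constructor
    · rintro ⟨q, ⟨⟨hqt, hqb, hqd⟩, hqp⟩, rfl⟩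
      have hq : ∀ j, N ≤ j → q (t, j) = 0 := fun j => eq_zero_of_lexLePart hqp hp
      rw [totalDeg_eq_degOn hqt] at hqd
      exact ⟨(row_mem_level_iff hk hq).2 ⟨hqb t, hqd⟩, (lexLePart_iff hq hp).1 hqp⟩
    · rintro ⟨hx, hxp⟩
      have hq : ∀ j, N ≤ j → ofRow t x (t, j) = 0 := fun j => ofRow_of_le x
      have hqt : ∀ v ∈ (ofRow t x).support, v.1 = t := fun v hv => by
        by_contra h
        exact Finsupp.mem_support_iff.1 hv (ofRow_of_ne x h)
      rw [← row_ofRow (t := t) x] at hx hxp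
      obtain ⟨hqb, hqd⟩ := (row_mem_level_iff hk hq).1 hx
      refine ⟨ofRow t x, ⟨⟨hqt, fun i j hij => ?_, (totalDeg_eq_degOn hqt).trans hqd⟩,
        (lexLePart_iff hq hp).2 hxp⟩, row_ofRow x⟩
      obtain rfl : i = t := hqt _ (Finsupp.mem_support_iff.2 hij)
      exact hqb j hij
  · rintro q ⟨⟨hqt, -⟩, hqp⟩ r ⟨⟨hrt, -⟩, hrp⟩ h
    refine row_injOn (fun v hv => ?_) (fun j => eq_zero_of_lexLePart hqp hp)
      (fun j => eq_zero_of_lexLePart hrp hp) h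
    rw [Finsupp.notMem_support_iff.1 fun h => hv (hqt v h),
      Finsupp.notMem_support_iff.1 fun h => hv (hrt v h)]

theorem rowBound_antitone (hmono : ∀ j ∈ S t, ∀ k ∈ S t, j ≤ k → e t k ≤ e t j) {N D : ℕ}
    {i j : Fin N} (hi : 0 < rowBound S e t N D i) (hij : i < j) :
    rowBound S e t N D j ≤ rowBound S e t N D i := by
  have hiS : (i : ℕ) ∈ S t := by
    by_contra h
    simp [rowBound, h] at hi
  by_cases hjS : (j : ℕ) ∈ S t
  · simp only [rowBound, hiS, hjS, if_true]
    refine ENat.toNat_le_toNat (min_le_min_right _ (hmono _ hiS _ hjS hij.le)) ?_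
    exact ne_top_of_le_ne_top (ENat.natCast_ne_top D) (min_le_right _ _)
  · simp [rowBound, hjS]

theorem row_add_single {N : ℕ} (p : MCMon n) (j : Fin N) :
    row t N (p + Finsupp.single (t, (j : ℕ)) 1) = row t N p + Pi.single j 1 := by
  funext k
  by_cases h : k = j
  · subst h
    simp [row]
  · have : (j : ℕ) ≠ k := fun h' => h (Fin.ext h'.symm)
    simp [row, h, this]

theorem exists_forall_mem_eq_zero (hfin : M.Finite) (t : Fin n) :
    ∃ N, ∀ m ∈ M, ∀ j, N ≤ j → m (t, j) = 0 := by
  choose N hN using exists_forall_le_eq_zero t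
  refine ⟨hfin.toFinset.sup N, fun m hm j hj => hN m j ?_⟩
  exact (Finset.le_sup (f := N) (hfin.mem_toFinset.2 hm)).trans hj

theorem mem_compressOp_of_add_single (hfin : M.Finite) (hmc : IsMulticomplex M)
    (hbd : ∀ m ∈ M, InBounds S e m)
    (hmono : ∀ j ∈ S t, ∀ k ∈ S t, j ≤ k → e t k ≤ e t j) {p : MCMon n} {j : ℕ}
    (h : p + Finsupp.single (t, j) 1 ∈ compressOp S e M t) : p ∈ compressOp S e M t := by
  classical
  obtain ⟨⟨m₀, hm₀, hm₀p⟩, hok, hcard⟩ := h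
  obtain ⟨N₁, hN₁⟩ := exists_forall_mem_eq_zero hfin t
  obtain ⟨N₂, hN₂⟩ := exists_forall_le_eq_zero t (p + Finsupp.single (t, j) 1)
  obtain ⟨N, hNM, hNq⟩ : ∃ N, (∀ m ∈ M, ∀ j, N ≤ j → m (t, j) = 0) ∧
      ∀ k, N ≤ k → (p + Finsupp.single (t, j) 1 : MCMon n) (t, k) = 0 :=
    ⟨max N₁ N₂, fun m hm j hj => hN₁ m hm j (le_trans (le_max_left _ _) hj),
      fun j hj => hN₂ j (le_trans (le_max_right _ _) hj)⟩
  have hjN : j < N := by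
    by_contra hj
    have := hNq j (not_lt.1 hj)
    simp at this
  obtain ⟨j, rfl⟩ : ∃ i : Fin N, (i : ℕ) = j := ⟨⟨j, hjN⟩, rfl⟩
  set p₁ := p + Finsupp.single (t, (j : ℕ)) 1 with hp₁
  have hle : ∀ v, p v ≤ p₁ v := fun v => by simp [hp₁]
  have hNp : ∀ k, N ≤ k → p (t, k) = 0 := fun k hk => by
    have := hle (t, k)
    rw [hNq k hk] at this
    omega
  have hagree : ∀ {m}, agreeAway t m p₁ ↔ agreeAway t m p := fun {m} =>
    forall₂_congr fun v hv => by
      have : (t, (j : ℕ)) ≠ v := fun h => hv (by rw [← h])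
      simp [hp₁, this]
  have hrow : row t N p₁ = row t N p + Pi.single j 1 := row_add_single p j
  have hdeg : degOn t p₁ = degOn t p + 1 := by
    rw [degOn_eq_sum_row hNq, degOn_eq_sum_row hNp, hrow, sum_add_single]
  have hokp : colorPartOk S e t p := fun k hk => by
    have hk' := hle (t, k)
    obtain ⟨h₁, h₂⟩ := hok k (by omega)
    exact ⟨h₁, le_trans (by exact_mod_cast hk') h₂⟩
  refine ⟨⟨m₀, hm₀, hagree.1 hm₀p⟩, hokp, ?_⟩
  set d := degOn t p
  rw [hdeg] at hcard
  rw [ncard_lexLePart (N := N) le_rfl hNq] at hcard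
  rw [ncard_lexLePart (N := N) (D := d + 1) (Nat.le_succ d) hNp]
  set hi := rowBound S e t N (d + 1)
  set F := fun k => {m | m ∈ M ∧ agreeAway t m p ∧ degOn t m = k}
  have hF : ∀ k, (F k).Finite := fun k => hfin.subset fun m hm => hm.1
  set A := (hF (d + 1)).toFinset.image (row t N)
  set I := (level 0 hi (d + 1)).filter fun x => toColex x ≤ toColex (row t N p₁)
  have hinj : ∀ k, Set.InjOn (row t N) (F k) := fun k m hm m' hm' =>
    row_injOn (fun v hv => (hm.2.1 v hv).trans (hm'.2.1 v hv).symm) (hNM m hm.1) (hNM m' hm'.1)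
  have hA : A ⊆ level 0 hi (d + 1) := by
    intro x hx
    obtain ⟨m, hm, rfl⟩ := Finset.mem_image.1 hx
    have hm := (hF _).mem_toFinset.1 hm
    exact (row_mem_level_iff le_rfl (hNM m hm.1)).2 ⟨hbd m hm.1 t, hm.2.2⟩
  have hI : IsInit toColex (level 0 hi (d + 1)) I :=
    ⟨Finset.filter_subset _ _, fun y hy x hx hxy =>
      Finset.mem_filter.2 ⟨hx, hxy.trans (Finset.mem_filter.1 hy).2⟩⟩
  have hIA : #I ≤ #A := by
    refine hcard.trans (le_of_eq ?_)
    rw [Finset.card_image_of_injOn (by simpa using hinj (d + 1)),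
      ← Set.ncard_eq_toFinset_card _ (hF (d + 1))]
    simp only [hagree, F]
  have hp₁I : row t N p₁ ∈ I :=
    Finset.mem_filter.2 ⟨(row_mem_level_iff le_rfl hNq).2 ⟨hok, hdeg⟩, le_rfl⟩
  have hpI : row t N p ∈ shadow 0 hi d I :=
    mem_shadow.2 ⟨(row_mem_level_iff (Nat.le_succ d) hNp).2 ⟨hokp, rfl⟩, j, hrow ▸ hp₁I⟩
  refine (Finset.card_le_card (t := shadow 0 hi d I) fun x hx => ?_).trans ?_
  · obtain ⟨hx, hxp⟩ := (@Finset.mem_filter _ _ _ _ _).1 hx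
    exact hI.shadow.2 _ hpI x hx hxp
  calc #(shadow 0 hi d I) ≤ #(shadow 0 hi d A) := by
        refine card_shadow_le 0 hi (fun i hi' k _ hik => ?_) d hI hA hIA
        simpa using rowBound_antitone hmono (mem_free.1 hi') hik
    _ ≤ #((hF d).toFinset.image (row t N)) := by
      refine Finset.card_le_card fun x hx => ?_
      obtain ⟨hx, i, hxi⟩ := mem_shadow.1 hx
      obtain ⟨m, hm, hmx⟩ := Finset.mem_image.1 hxi
      obtain ⟨hmM, hmp, hmd⟩ := (hF _).mem_toFinset.1 hm
      have hms : Finsupp.single (t, (i : ℕ)) 1 ≤ m := by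
        rw [Finsupp.single_le_iff]
        have := congrFun hmx i
        rw [add_single_self] at this
        change m (t, i) = _ at this
        omega
      obtain ⟨m', rfl⟩ := exists_add_of_le hms
      rw [add_comm] at hmM hmp hmd hmx
      have hm'M : m' ∈ M := hmc.2 _ hmM m' fun v => by simp
      rw [row_add_single] at hmx
      have hm'x : row t N m' = x := add_right_cancel hmx
      refine Finset.mem_image.2 ⟨m', (hF d).mem_toFinset.2 ⟨hm'M, fun v hv => ?_, ?_⟩, hm'x⟩
      · have : (t, (i : ℕ)) ≠ v := fun h => hv (by rw [← h])
        rw [← hmp v hv]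
        simp [this]
      · rw [degOn_eq_sum_row (hNM m' hm'M), hm'x]
        exact (mem_level.1 hx).2
    _ ≤ #(hF d).toFinset := Finset.card_image_le
    _ = (F d).ncard := (Set.ncard_eq_toFinset_card _ _).symm

theorem mem_compressOp_of_add (hfin : M.Finite) (hmc : IsMulticomplex M)
    (hbd : ∀ m ∈ M, InBounds S e m)
    (hmono : ∀ j ∈ S t, ∀ k ∈ S t, j ≤ k → e t k ≤ e t j) {p r : MCMon n}
    (hr : ∀ v : Fin n × ℕ, v.1 ≠ t → r v = 0) (h : p + r ∈ compressOp S e M t) :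
    p ∈ compressOp S e M t := by
  induction r using Finsupp.induction_linear generalizing p with
  | zero => simpa using h
  | add f g hf hg =>
    rw [← add_assoc] at h
    have hfg : ∀ v : Fin n × ℕ, v.1 ≠ t → f v = 0 ∧ g v = 0 := fun v hv => by
      simpa using hr v hv
    exact hf (fun v hv => (hfg v hv).1) (hg (fun v hv => (hfg v hv).2) h)
  | single v k =>
    induction k with
    | zero => simpa using h
    | succ k ih =>
      rw [Finsupp.single_add, ← add_assoc] at h
      obtain ⟨i, j⟩ := v
      obtain rfl : i = t := by
        by_contra hi
        simpa using hr (i, j) hi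
      refine ih (fun v hv => ?_) (mem_compressOp_of_add_single hfin hmc hbd hmono h)
      have : (i, j) ≠ v := fun h => hv (by rw [← h])
      simp [this]

theorem mem_compressOp_of_le_of_eq (hfin : M.Finite) (hmc : IsMulticomplex M) {p p' : MCMon n}
    (h : p ∈ compressOp S e M t) (hle : ∀ v, p' v ≤ p v) (heq : ∀ j, p' (t, j) = p (t, j)) :
    p' ∈ compressOp S e M t := by
  obtain ⟨⟨m₀, hm₀, hm₀p⟩, hok, hcard⟩ := h
  let φ : MCMon n → MCMon n := fun m => m.filter (fun v => v.1 = t) + p'.filter (fun v => v.1 ≠ t)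
  have hφt : ∀ m j, φ m (t, j) = m (t, j) := fun m j => by simp [φ]
  have hφp : ∀ m, agreeAway t (φ m) p' := fun m v hv => by simp [φ, hv]
  have hφM : ∀ m ∈ M, agreeAway t m p → φ m ∈ M := fun m hm hmp =>
    hmc.2 m hm _ fun v => by
      obtain ⟨i, j⟩ := v
      by_cases hi : i = t
      · subst hi
        exact (hφt m j).le
      · rw [hφp m (i, j) hi, hmp (i, j) hi]
        exact hle _
  refine ⟨⟨φ m₀, hφM m₀ hm₀ hm₀p, hφp m₀⟩, fun j => by rw [heq]; exact hok j, ?_⟩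
  have hlex : ∀ q, lexLePart t q p' ↔ lexLePart t q p := fun q => by simp only [lexLePart, heq]
  simp only [hlex, degOn_congr heq]
  refine hcard.trans (Set.ncard_le_ncard_of_injOn φ ?_ ?_ (hfin.subset fun m hm => hm.1))
  · rintro m ⟨hm, hmp, hmd⟩
    exact ⟨hφM m hm hmp, hφp m, (degOn_congr (hφt m)).trans hmd⟩
  · rintro m ⟨-, hm, -⟩ m' ⟨-, hm', -⟩ hmm'
    refine eq_of_agreeAway (fun v hv => (hm v hv).trans (hm' v hv).symm) fun j => ?_
    rw [← hφt m, ← hφt m', hmm']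

theorem zero_mem_compressOp (hfin : M.Finite) (hmc : IsMulticomplex M) :
    (0 : MCMon n) ∈ compressOp S e M t := by
  have h0 : (0 : MCMon n) ∈ M := by
    obtain ⟨m, hm⟩ := hmc.1
    exact hmc.2 m hm 0 fun v => Nat.zero_le _
  refine ⟨⟨0, h0, fun _ _ => rfl⟩, fun j hj => absurd rfl hj, ?_⟩
  calc _ ≤ ({0} : Set (MCMon n)).ncard := by
        refine Set.ncard_le_ncard ?_ (Set.finite_singleton _)
        rintro q ⟨⟨-, -, hq⟩, -⟩
        have hq : ∑ v ∈ q.support, q v = 0 := hq.trans (by simp [degOn])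
        ext v
        by_contra hv
        exact hv (Finset.sum_eq_zero_iff.1 hq v (Finsupp.mem_support_iff.2 hv))
    _ ≤ _ := by
        refine Set.ncard_le_ncard ?_ (hfin.subset fun m hm => hm.1)
        rintro _ rfl
        exact ⟨h0, fun _ _ => rfl, rfl⟩

end Compression

/-- If the bound sequence of color `t` is weakly decreasing, then
`C_t(M)` is a multicomplex. -/
theorem compressOp_isMulticomplex {n : ℕ} (S : Fin n → Set ℕ) (hS : ∀ i, (S i).Nonempty)
    (e : Fin n → ℕ → ℕ∞) (he : ∀ i, ∀ j ∈ S i, 1 ≤ e i j)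
    (a : Fin n → ℕ) (ha : ∀ i, 0 < a i) (M : Set (MCMon n))
    (hfin : M.Finite) (hmc : IsMulticomplex M)
    (hbd : ∀ m ∈ M, InBounds S e m) (htype : IsColoredType a M)
    (t : Fin n) (hmono : ∀ j ∈ S t, ∀ k ∈ S t, j ≤ k → e t k ≤ e t j) :
    IsMulticomplex (compressOp S e M t) := by
  refine ⟨⟨0, zero_mem_compressOp hfin hmc⟩, fun p hp p' hle => ?_⟩
  have hp' : p' + (p - p').filter (fun v => v.1 = t) ∈ compressOp S e M t := by
    refine mem_compressOp_of_le_of_eq hfin hmc hp (fun v => ?_) fun j => ?_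
    · have := hle v
      by_cases hv : v.1 = t
      · simp [hv]
        omega
      · simpa [hv] using this
    · have := hle (t, j)
      simp
      omega
  exact mem_compressOp_of_add hfin hmc hbd hmono (fun v hv => by simp [hv]) hp'
end

section
/- Let a ∈ ℙ^n and let f = {f_b}_{b ≤ a} be an array of integers. Then f is the fine f-vector of a colored complex of type a if and only if f is the fine f-vector of a color-compressed colored complex of type a. -/
open Finset

/-- The vertex set of a finite simplicial complex, given as its finite set of faces. -/
def vertexSet {α : Type*} [DecidableEq α] (Δ : Finset (Finset α)) : Finset α := Δ.sup id

/-- `Δ` is a (finite) simplicial complex: a nonempty collection of finite subsets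
closed under taking subsets.  (Every member of some face then automatically spans
a face, so the vertex condition is automatic.) -/
def IsSimplicialComplex {α : Type*} (Δ : Finset (Finset α)) : Prop :=
  Δ.Nonempty ∧ ∀ F ∈ Δ, ∀ G ⊆ F, G ∈ Δ

/-- The deletion `dl_Δ(x)` of the vertex `x` from `Δ`. -/
def del {α : Type*} [DecidableEq α] (Δ : Finset (Finset α)) (x : α) : Finset (Finset α) :=
  Δ.filter fun τ => x ∉ τ

/-- The link `lk_Δ(x)` of the vertex `x` in `Δ`. -/
def lk {α : Type*} [DecidableEq α] (Δ : Finset (Finset α)) (x : α) : Finset (Finset α) :=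
  Δ.filter fun τ => x ∉ τ ∧ insert x τ ∈ Δ

/-- `F` is a facet (maximal face) of `Δ`. -/
def IsFacet {α : Type*} (Δ : Finset (Finset α)) (F : Finset α) : Prop :=
  F ∈ Δ ∧ ∀ G ∈ Δ, F ⊆ G → G = F

/-- The simplicial complex `⟨ℱ⟩` generated by a collection `ℱ` of faces. -/
def generatedComplex {α : Type*} [DecidableEq α] (S : Finset (Finset α)) :
    Finset (Finset α) :=
  insert ∅ (S.biUnion Finset.powerset)

/-- `(V 0, …, V (n-1))` is an ordered partition of `W` into nonempty parts. -/
def IsOrderedPartition {α : Type*} [DecidableEq α] {n : ℕ} (V : Fin n → Finset α)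
    (W : Finset α) : Prop :=
  (∀ i, (V i).Nonempty) ∧ (∀ i j, i ≠ j → Disjoint (V i) (V j)) ∧
    Finset.univ.biUnion V = W

/-- `Γ` is an `a`-rib of `Δ`: there is an ordered partition `V` of the vertex set
of `Δ` such that `Γ` is generated by the faces `F` of `Δ` with `|F ∩ V i| = a i`
for every `i`. -/
def IsRib {α : Type*} [DecidableEq α] {n : ℕ} (a : Fin n → ℕ) (Δ Γ : Finset (Finset α)) :
    Prop :=
  ∃ V : Fin n → Finset α, IsOrderedPartition V (vertexSet Δ) ∧
    (Δ.filter fun F => ∀ i, (F ∩ V i).card = a i).Nonempty ∧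
    Γ = generatedComplex (Δ.filter fun F => ∀ i, (F ∩ V i).card = a i)

/-- `Γ` is an `a`-rib of a simplex. -/
def IsRibOfSimplex {α : Type*} [DecidableEq α] {n : ℕ} (a : Fin n → ℕ)
    (Γ : Finset (Finset α)) : Prop :=
  ∃ F : Finset α, F.Nonempty ∧ IsRib a F.powerset Γ

/-- Vertex decomposability, in the non-pure sense of Björner and Wachs. -/
inductive VertexDecomposable {α : Type*} [DecidableEq α] : Finset (Finset α) → Prop
  | simplex (F : Finset α) (hF : F.Nonempty) : VertexDecomposable F.powerset
  | ofEmpty : VertexDecomposable {∅}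
  | shed (Δ : Finset (Finset α)) (x : α) (hC : IsSimplicialComplex Δ) (hx : {x} ∈ Δ)
      (hdl : VertexDecomposable (del Δ x)) (hlk : VertexDecomposable (lk Δ x))
      (hfac : ∀ F, IsFacet (lk Δ x) F → ¬ IsFacet (del Δ x) F) :
      VertexDecomposable Δ

/-- `a`-Macaulay decomposability. -/
inductive MacaulayDecomposable {α : Type*} [DecidableEq α] {n : ℕ} :
    (Fin n → ℕ) → Finset (Finset α) → Prop
  | rib (a : Fin n → ℕ) (Γ : Finset (Finset α)) (h : IsRibOfSimplex a Γ) :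
      MacaulayDecomposable a Γ
  | shed (a a' : Fin n → ℕ) (Δ : Finset (Finset α)) (x : α)
      (hC : IsSimplicialComplex Δ) (hx : {x} ∈ Δ) (hlt : a' < a)
      (hdl : MacaulayDecomposable a (del Δ x))
      (hlk : MacaulayDecomposable a' (lk Δ x))
      (hfac : ∀ F, IsFacet (lk Δ x) F → ¬ IsFacet (del Δ x) F) :
      MacaulayDecomposable a Δ

/-- `(Δ, V)` is a colored complex of type `a`. -/
def IsColoredComplex {α : Type*} [DecidableEq α] {n : ℕ} (a : Fin n → ℕ)
    (Δ : Finset (Finset α)) (V : Fin n → Finset α) : Prop :=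
  IsSimplicialComplex Δ ∧ IsOrderedPartition V (vertexSet Δ) ∧
    ∀ F ∈ Δ, ∀ i, (F ∩ V i).card ≤ a i

/-- `(Δ, V)` is a balanced complex of type `a`: an `a`-colored complex of
dimension `|a| - 1`. -/
def IsBalancedComplex {α : Type*} [DecidableEq α] {n : ℕ} (a : Fin n → ℕ)
    (Δ : Finset (Finset α)) (V : Fin n → Finset α) : Prop :=
  IsColoredComplex a Δ V ∧ (∀ F ∈ Δ, F.card ≤ ∑ i, a i) ∧ ∃ F ∈ Δ, F.card = ∑ i, a i

/-- `(Δ, V)` is color-shifted (with respect to the linear order on the vertices). -/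
def IsColorShifted {α : Type*} [LinearOrder α] {n : ℕ} (Δ : Finset (Finset α))
    (V : Fin n → Finset α) : Prop :=
  ∀ F ∈ Δ, ∀ i : Fin n, ∀ v ∈ V i, ∀ v' ∈ V i,
    v' < v → v ∈ F → v' ∉ F → insert v' (F.erase v) ∈ Δ

/-- `Δ` is pure: all facets have the same dimension. -/
def IsPureComplex {α : Type*} (Δ : Finset (Finset α)) : Prop :=
  ∀ F G, IsFacet Δ F → IsFacet Δ G → F.card = G.card

/-- `f` is the fine f-vector of the colored complex `(Δ, V)` of type `a`. -/
def HasFineFVector {α : Type*} [DecidableEq α] {n : ℕ} (a : Fin n → ℕ)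
    (Δ : Finset (Finset α)) (V : Fin n → Finset α) (f : (Fin n → ℕ) → ℤ) : Prop :=
  ∀ b : Fin n → ℕ, (∀ i, b i ≤ a i) →
    f b = ((Δ.filter fun F => ∀ i, (F ∩ V i).card = b i).card : ℤ)

/-- `A ≤ B` in the colexicographic order: either `A = B`, or the maximum element
of the symmetric difference `A △ B` lies in `B`. -/
def colexLE {α : Type*} [LinearOrder α] (A B : Finset α) : Prop :=
  A = B ∨ ∃ k, k ∈ B ∧ k ∉ A ∧ ∀ x, k < x → (x ∈ A ↔ x ∈ B)

/-- `(Δ, V)` is color-compressed: for every face `F` and color `t`, the set of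
`|F ∩ V t|`-subsets of `V t` that can replace `F ∩ V t` in `F` is an
initial segment of the colex order. -/
def IsColorCompressedComplex {α : Type*} [LinearOrder α] {n : ℕ}
    (Δ : Finset (Finset α)) (V : Fin n → Finset α) : Prop :=
  ∀ F ∈ Δ, ∀ t : Fin n, ∀ G ⊆ V t, G.card = (F ∩ V t).card →
    colexLE G (F ∩ V t) → (F \ V t) ∪ G ∈ Δ

open scoped FinsetFamily

/-- The number of subsets of `W` with as many elements as `G` that precede `G` in colex. -/
def colexRank (W G : Finset ℕ) : ℕ :=
  #{H ∈ powersetCard #G W | toColex H < toColex G}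

/-- The `k`-subsets of `W` that extend `R` to a face of `Δ`. -/
def extensions (W : Finset ℕ) (Δ : Finset (Finset ℕ)) (R : Finset ℕ) (k : ℕ) :
    Finset (Finset ℕ) :=
  {G ∈ powersetCard k W | R ∪ G ∈ Δ}

/-- The compression of `Δ`, a family of subsets of `U`, with respect to the part `W`: every
family of `k`-subsets of `W` extending a fixed set is replaced by the colex-initial segment of the
same size. -/
def colexCompression (U W : Finset ℕ) (Δ : Finset (Finset ℕ)) : Finset (Finset ℕ) :=
  {F ∈ U.powerset | colexRank W (F ∩ W) < #(extensions W Δ (F \ W) #(F ∩ W))}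

lemma mem_extensions {W R G : Finset ℕ} {Δ : Finset (Finset ℕ)} {k : ℕ} :
    G ∈ extensions W Δ R k ↔ (G ⊆ W ∧ #G = k) ∧ R ∪ G ∈ Δ := by
  simp [extensions, mem_powersetCard]

lemma extensions_subset_powersetCard (W : Finset ℕ) (Δ : Finset (Finset ℕ)) (R : Finset ℕ) (k : ℕ) :
    extensions W Δ R k ⊆ powersetCard k W :=
  filter_subset _ _

lemma mem_colexCompression {U W F : Finset ℕ} {Δ : Finset (Finset ℕ)} :
    F ∈ colexCompression U W Δ ↔
      F ⊆ U ∧ colexRank W (F ∩ W) < #(extensions W Δ (F \ W) #(F ∩ W)) := by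
  simp [colexCompression]

lemma colexRank_lt_card {W G : Finset ℕ} (hG : G ⊆ W) :
    colexRank W G < #(powersetCard #G W) := by
  refine card_lt_card (filter_ssubset.2 ⟨G, mem_powersetCard.2 ⟨hG, rfl⟩, lt_irrefl _⟩)

lemma colexRank_lt_colexRank {W G H : Finset ℕ} (hG : G ⊆ W) (hcard : #G = #H)
    (h : toColex G < toColex H) : colexRank W G < colexRank W H := by
  refine card_lt_card ⟨fun K hK => ?_, fun hsub => ?_⟩
  · rw [mem_filter, hcard] at hK
    exact mem_filter.2 ⟨hK.1, hK.2.trans h⟩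
  · have := hsub (mem_filter.2 ⟨mem_powersetCard.2 ⟨hG, hcard⟩, h⟩)
    exact lt_irrefl _ (mem_filter.1 this).2

lemma colexRank_injOn (W : Finset ℕ) (k : ℕ) :
    Set.InjOn (colexRank W) (powersetCard k W : Finset (Finset ℕ)) := by
  intro G hG H hH h
  rw [mem_coe, mem_powersetCard] at hG hH
  rcases lt_trichotomy (toColex G) (toColex H) with hlt | heq | hlt
  · exact absurd h (colexRank_lt_colexRank hG.1 (hG.2.trans hH.2.symm) hlt).ne
  · exact toColex_inj.1 heq
  · exact absurd h (colexRank_lt_colexRank hH.1 (hH.2.trans hG.2.symm) hlt).ne'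

lemma image_colexRank (W : Finset ℕ) (k : ℕ) :
    (powersetCard k W).image (colexRank W) = range #(powersetCard k W) := by
  refine eq_of_subset_of_card_le (fun r hr => ?_) ?_
  · obtain ⟨G, hG, rfl⟩ := mem_image.1 hr
    rw [mem_powersetCard] at hG
    rw [mem_range, ← hG.2]
    exact colexRank_lt_card hG.1
  · rw [card_range, card_image_of_injOn (colexRank_injOn W k)]

lemma card_filter_colexRank_lt {W : Finset ℕ} {k m : ℕ} (hm : m ≤ #(powersetCard k W)) :
    #{G ∈ powersetCard k W | colexRank W G < m} = m := by
  rw [← card_image_of_injOn ((colexRank_injOn W k).mono (filter_subset _ _))]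
  rw [← filter_image (p := fun r => r < m), image_colexRank]
  have : {r ∈ range #(powersetCard k W) | r < m} = range m := by
    ext r
    simp only [mem_filter, mem_range]
    omega
  rw [this, card_range]

/-- Kruskal–Katona for a single member of an initial segment. -/
lemma card_initSeg_erase_le {N : ℕ} {𝒜 : Finset (Finset (Fin N))} {G : Finset (Fin N)}
    (h𝒜 : (𝒜 : Set (Finset (Fin N))).Sized #G) (hG : #(Colex.initSeg G) ≤ #𝒜) {v : Fin N}
    (hv : v ∈ G) : #(Colex.initSeg (G.erase v)) ≤ #(∂ 𝒜) := by
  refine le_trans (card_le_card ?_) (kruskal_katona h𝒜 hG Colex.isInitSeg_initSeg)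
  have hmem : G.erase v ∈ ∂ (Colex.initSeg G) := erase_mem_shadow Colex.mem_initSeg_self hv
  have hseg := (Colex.isInitSeg_initSeg (s := G)).shadow
  intro H hH
  rw [Colex.mem_initSeg] at hH
  rcases hH.2.eq_or_lt with heq | hlt
  · rwa [toColex_inj.1 heq]
  · exact hseg.2 hmem ⟨hlt, by rw [← hH.1, card_erase_of_mem hv]⟩

lemma colexRank_map {W : Finset ℕ} {N : ℕ} {e : Fin N ↪o ℕ} (he : univ.map e.toEmbedding = W)
    (G : Finset (Fin N)) :
    colexRank W (G.map e.toEmbedding) + 1 = #(Colex.initSeg G) := by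
  have hlt : ∀ H : Finset (Fin N), toColex (H.map e.toEmbedding) < toColex (G.map e.toEmbedding) ↔
      toColex H < toColex G := fun H => by
    rw [map_eq_image, map_eq_image]
    exact Colex.toColex_image_lt_toColex_image e.strictMono
  have hseg : Colex.initSeg G =
      insert G {H ∈ powersetCard #G (univ : Finset (Fin N)) | toColex H < toColex G} := by
    ext H
    simp only [Colex.mem_initSeg, mem_insert, mem_filter, mem_powersetCard, subset_univ, true_and]
    rw [le_iff_eq_or_lt, toColex_inj]
    constructor
    · rintro ⟨h, rfl | h'⟩
      exacts [Or.inl rfl, Or.inr ⟨h.symm, h'⟩]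
    · rintro (rfl | ⟨h, h'⟩)
      exacts [⟨rfl, Or.inl rfl⟩, ⟨h.symm, Or.inr h'⟩]
  rw [hseg, card_insert_of_notMem (by simp), colexRank, ← he, card_map, powersetCard_map,
    filter_map, card_map]
  congr 2
  refine filter_congr fun H _ => ?_
  exact hlt H

lemma colexRank_erase_lt {W G : Finset ℕ} {𝒜 ℬ : Finset (Finset ℕ)} (hGW : G ⊆ W)
    (h𝒜 : 𝒜 ⊆ powersetCard #G W) (hℬ : ∀ A ∈ 𝒜, ∀ v ∈ A, A.erase v ∈ ℬ)
    (hG : colexRank W G < #𝒜) {v : ℕ} (hv : v ∈ G) : colexRank W (G.erase v) < #ℬ := by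
  set e : Fin #W ↪o ℕ := W.orderEmbOfFin rfl
  have he : univ.map e.toEmbedding = W := map_orderEmbOfFin_univ W rfl
  have hpre : ∀ H ⊆ W, ∃ K : Finset (Fin #W), K.map e.toEmbedding = H := fun H hH => by
    rw [← he] at hH
    obtain ⟨K, -, rfl⟩ := subset_map_iff.1 hH
    exact ⟨K, rfl⟩
  obtain ⟨G, rfl⟩ := hpre G hGW
  obtain ⟨v, hvG, rfl⟩ := mem_map.1 hv
  set 𝒞 : Finset (Finset (Fin #W)) := {A | A.map e.toEmbedding ∈ 𝒜}
  have hcard : #𝒞 = #𝒜 := by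
    refine card_nbij (fun A => A.map e.toEmbedding) (fun A hA => (mem_filter.1 hA).2)
      (map_injective e.toEmbedding).injOn fun A hA => ?_
    obtain ⟨A, rfl⟩ := hpre A (mem_powersetCard.1 (h𝒜 hA)).1
    exact ⟨A, mem_coe.2 (mem_filter.2 ⟨mem_univ _, hA⟩), rfl⟩
  have hsized : (𝒞 : Set (Finset (Fin #W))).Sized #G := fun A hA => by
    simpa using (mem_powersetCard.1 (h𝒜 (mem_filter.1 (mem_coe.1 hA)).2)).2
  have hle := card_initSeg_erase_le hsized (by rw [hcard, ← colexRank_map he]; exact hG) hvG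
  have hshadow : #(∂ 𝒞) ≤ #ℬ := by
    refine card_le_card_of_injOn (fun A => A.map e.toEmbedding) (fun B hB => ?_)
      (map_injective e.toEmbedding).injOn
    obtain ⟨A, hA, w, hw, rfl⟩ := mem_shadow_iff.1 hB
    simpa only [map_erase, mem_coe] using hℬ _ (mem_filter.1 hA).2 _ (mem_map_of_mem _ hw)
  rw [← map_erase, ← Nat.succ_le_iff, Nat.succ_eq_add_one, colexRank_map he]
  exact hle.trans hshadow

lemma union_sdiff_eq_left {R G W : Finset ℕ} (hR : Disjoint R W) (hG : G ⊆ W) :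
    (R ∪ G) \ W = R := by
  rw [union_sdiff_distrib, sdiff_eq_empty_iff_subset.2 hG, union_empty, hR.sdiff_eq_left]

lemma union_inter_eq_right {R G W : Finset ℕ} (hR : Disjoint R W) (hG : G ⊆ W) :
    (R ∪ G) ∩ W = G := by
  rw [union_inter_distrib_right, disjoint_iff_inter_eq_empty.1 hR, empty_union,
    inter_eq_left.2 hG]

lemma union_mem_colexCompression {U W R G : Finset ℕ} {Δ : Finset (Finset ℕ)}
    (hR : Disjoint R W) (hG : G ⊆ W) (hWU : W ⊆ U) :
    R ∪ G ∈ colexCompression U W Δ ↔ R ⊆ U ∧ colexRank W G < #(extensions W Δ R #G) := by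
  rw [mem_colexCompression, union_sdiff_eq_left hR hG, union_inter_eq_right hR hG,
    union_subset_iff]
  exact and_congr_left fun _ => and_iff_left (hG.trans hWU)

lemma card_extensions_colexCompression {U W R : Finset ℕ} {Δ : Finset (Finset ℕ)}
    (hR : Disjoint R W) (hRU : R ⊆ U) (hWU : W ⊆ U) (k : ℕ) :
    #(extensions W (colexCompression U W Δ) R k) = #(extensions W Δ R k) := by
  have hle : #(extensions W Δ R k) ≤ #(powersetCard k W) :=
    card_le_card (extensions_subset_powersetCard W Δ R k)
  rw [← card_filter_colexRank_lt hle, extensions]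
  congr 1
  refine filter_congr fun G hG => ?_
  rw [mem_powersetCard] at hG
  rw [union_mem_colexCompression hR hG.1 hWU, and_iff_right hRU, hG.2]

lemma mem_colexCompression_of_forall {U W F : Finset ℕ} {Δ : Finset (Finset ℕ)} (hF : F ⊆ U)
    (h : ∀ G ⊆ W, #G = #(F ∩ W) → F \ W ∪ G ∈ Δ) : F ∈ colexCompression U W Δ := by
  refine mem_colexCompression.2 ⟨hF, (colexRank_lt_card inter_subset_right).trans_le ?_⟩
  refine card_le_card fun G hG => ?_
  rw [mem_powersetCard] at hG
  exact mem_extensions.2 ⟨hG, h G hG.1 hG.2⟩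

lemma exists_of_mem_colexCompression {U W F : Finset ℕ} {Δ : Finset (Finset ℕ)}
    (hF : F ∈ colexCompression U W Δ) : ∃ G ⊆ W, #G = #(F ∩ W) ∧ F \ W ∪ G ∈ Δ := by
  obtain ⟨G, hG⟩ := card_pos.1 ((Nat.zero_le _).trans_lt (mem_colexCompression.1 hF).2)
  rw [mem_extensions] at hG
  exact ⟨G, hG.1.1, hG.1.2, hG.2⟩

lemma mem_of_subset_of_forall_erase_mem {Δ : Finset (Finset ℕ)}
    (h : ∀ F ∈ Δ, ∀ v ∈ F, F.erase v ∈ Δ) {F : Finset ℕ} (hF : F ∈ Δ) {G : Finset ℕ}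
    (hG : G ⊆ F) : G ∈ Δ := by
  induction F using Finset.strongInduction with
  | H F ih =>
    rcases hG.eq_or_ssubset with rfl | hss
    · exact hF
    · obtain ⟨v, hv, hvG⟩ := exists_of_ssubset hss
      exact ih _ (erase_ssubset hv) (h F hF v hv) (subset_erase.2 ⟨hG, hvG⟩)

lemma IsSimplicialComplex.colexCompression {Δ : Finset (Finset ℕ)} (hΔ : IsSimplicialComplex Δ)
    (U W : Finset ℕ) : IsSimplicialComplex (colexCompression U W Δ) := by
  obtain ⟨⟨F₀, hF₀⟩, hdown⟩ := hΔ
  refine ⟨⟨∅, mem_colexCompression_of_forall (empty_subset _) fun G _ hG => ?_⟩,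
    fun F hF G hG => mem_of_subset_of_forall_erase_mem (fun F hF v hv => ?_) hF hG⟩
  · have : G = ∅ := by simpa using hG
    simpa [this] using hdown F₀ hF₀ ∅ (empty_subset _)
  · rw [mem_colexCompression] at hF ⊢
    refine ⟨(erase_subset _ _).trans hF.1, ?_⟩
    by_cases hvW : v ∈ W
    · have h₁ : F.erase v \ W = F \ W := by
        ext x
        simp only [mem_sdiff, mem_erase]
        exact ⟨fun h => ⟨h.1.2, h.2⟩, fun h => ⟨⟨fun hx => h.2 (hx ▸ hvW), h.1⟩, h.2⟩⟩
      rw [h₁, erase_inter]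
      have hvFW : v ∈ F ∩ W := mem_inter.2 ⟨hv, hvW⟩
      refine colexRank_erase_lt inter_subset_right
        (extensions_subset_powersetCard W Δ (F \ W) _) (fun A hA w hw => ?_) hF.2 hvFW
      rw [mem_extensions] at hA ⊢
      refine ⟨⟨(erase_subset _ _).trans hA.1.1, ?_⟩,
        hdown _ hA.2 _ (union_subset_union_right (erase_subset _ _))⟩
      rw [card_erase_of_mem hw, card_erase_of_mem hvFW, hA.1.2]
    · have h₁ : F.erase v ∩ W = F ∩ W := by
        rw [erase_inter, erase_eq_of_notMem fun h => hvW (mem_inter.1 h).2]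
      rw [h₁]
      refine hF.2.trans_le (card_le_card fun A hA => ?_)
      rw [mem_extensions] at hA ⊢
      exact ⟨hA.1, hdown _ hA.2 _
        (union_subset_union_left (sdiff_subset_sdiff (erase_subset _ _) le_rfl))⟩

lemma subset_vertexSet {Δ : Finset (Finset ℕ)} {F : Finset ℕ} (hF : F ∈ Δ) :
    F ⊆ vertexSet Δ := le_sup (f := id) hF

lemma singleton_mem_of_mem_vertexSet {Δ : Finset (Finset ℕ)} (hΔ : IsSimplicialComplex Δ) {v : ℕ}
    (hv : v ∈ vertexSet Δ) : {v} ∈ Δ := by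
  rw [vertexSet, mem_sup] at hv
  obtain ⟨F, hF, hvF⟩ := hv
  exact hΔ.2 F hF _ (singleton_subset_iff.2 hvF)

lemma vertexSet_colexCompression {Δ : Finset (Finset ℕ)} (hΔ : IsSimplicialComplex Δ)
    {W : Finset ℕ} (hW : W ⊆ vertexSet Δ) :
    vertexSet (colexCompression (vertexSet Δ) W Δ) = vertexSet Δ := by
  refine Subset.antisymm (Finset.sup_le fun F hF => (mem_colexCompression.1 hF).1) fun v hv => ?_
  refine subset_vertexSet (F := {v}) ?_ (mem_singleton_self v)
  refine mem_colexCompression_of_forall (singleton_subset_iff.2 hv) fun G hG hcard => ?_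
  by_cases hvW : v ∈ W
  · rw [singleton_inter_of_mem hvW, card_singleton] at hcard
    obtain ⟨w, rfl⟩ := card_eq_one.1 hcard
    rw [sdiff_eq_empty_iff_subset.2 (singleton_subset_iff.2 hvW), empty_union]
    exact singleton_mem_of_mem_vertexSet hΔ (hW (singleton_subset_iff.1 hG))
  · rw [singleton_inter_of_notMem hvW, card_empty, card_eq_zero] at hcard
    rw [hcard, union_empty, sdiff_eq_self_of_disjoint (disjoint_singleton_left.2 hvW)]
    exact singleton_mem_of_mem_vertexSet hΔ hv

lemma card_sdiff_union_inter {n : ℕ} {V : Fin n → Finset ℕ}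
    (hV : ∀ i j, i ≠ j → Disjoint (V i) (V j)) {t : Fin n} {F G : Finset ℕ} (hG : G ⊆ V t)
    (hcard : #G = #(F ∩ V t)) (i : Fin n) : #((F \ V t ∪ G) ∩ V i) = #(F ∩ V i) := by
  by_cases hi : i = t
  · subst hi
    rw [union_inter_eq_right sdiff_disjoint hG, hcard]
  · have h := disjoint_left.1 (hV i t hi)
    congr 1
    ext x
    simp only [mem_inter, mem_union, mem_sdiff]
    exact ⟨fun hx => ⟨hx.1.elim And.left fun hxG => absurd (hG hxG) (h hx.2), hx.2⟩,
      fun hx => ⟨Or.inl ⟨hx.1, h hx.2⟩, hx.2⟩⟩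

lemma IsColoredComplex.colexCompression {n : ℕ} {a : Fin n → ℕ} {Δ : Finset (Finset ℕ)}
    {V : Fin n → Finset ℕ} (h : IsColoredComplex a Δ V) (t : Fin n) :
    IsColoredComplex a (colexCompression (vertexSet Δ) (V t) Δ) V := by
  obtain ⟨hΔ, hV, ha⟩ := h
  have hVt : V t ⊆ vertexSet Δ := hV.2.2 ▸ subset_biUnion_of_mem V (mem_univ t)
  refine ⟨hΔ.colexCompression _ _, by rwa [vertexSet_colexCompression hΔ hVt], fun F hF i => ?_⟩
  obtain ⟨G, hG, hcard, hmem⟩ := exists_of_mem_colexCompression hF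
  rw [← card_sdiff_union_inter hV.2.1 hG hcard i]
  exact ha _ hmem i

/-- The fine face numbers are determined by the numbers of extensions into one part. -/
lemma card_filter_eq_sum_card_extensions {n : ℕ} {V : Fin n → Finset ℕ}
    (hV : ∀ i j, i ≠ j → Disjoint (V i) (V j)) (t : Fin n) (b : Fin n → ℕ) {U : Finset ℕ}
    {Δ : Finset (Finset ℕ)} (hΔ : ∀ F ∈ Δ, F ⊆ U) :
    #{F ∈ Δ | ∀ i, #(F ∩ V i) = b i} =
      ∑ R ∈ (U \ V t).powerset with ∀ i ≠ t, #(R ∩ V i) = b i, #(extensions (V t) Δ R (b t)) := by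
  have hinter : ∀ (F : Finset ℕ) (i : Fin n), i ≠ t → (F \ V t) ∩ V i = F ∩ V i := by
    intro F i hi
    ext x
    simp only [mem_inter, mem_sdiff]
    exact ⟨fun hx => ⟨hx.1.1, hx.2⟩, fun hx => ⟨⟨hx.1, disjoint_left.1 (hV i t hi) hx.2⟩, hx.2⟩⟩
  rw [card_eq_sum_card_fiberwise (f := fun F => F \ V t)
    (t := {R ∈ (U \ V t).powerset | ∀ i ≠ t, #(R ∩ V i) = b i})]
  · refine sum_congr rfl fun R hR => ?_
    rw [mem_filter, mem_powerset] at hR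
    have hRt : Disjoint R (V t) := disjoint_of_subset_left hR.1 sdiff_disjoint
    refine card_nbij' (fun F => F ∩ V t) (fun G => R ∪ G) (fun F hF => ?_) (fun G hG => ?_)
      (fun F hF => ?_) fun G hG => ?_
    · simp only [mem_coe, mem_filter] at hF
      refine mem_coe.2 (mem_extensions.2 ⟨⟨inter_subset_right, hF.1.2 t⟩, ?_⟩)
      rw [← hF.2, sdiff_union_inter]
      exact hF.1.1
    · rw [mem_coe, mem_extensions] at hG
      simp only [mem_coe, mem_filter]
      refine ⟨⟨hG.2, fun i => ?_⟩, union_sdiff_eq_left hRt hG.1.1⟩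
      by_cases hi : i = t
      · subst hi
        rw [union_inter_eq_right hRt hG.1.1, hG.1.2]
      · rw [← hinter _ i hi, union_sdiff_eq_left hRt hG.1.1]
        exact hR.2 i hi
    · simp only [mem_coe, mem_filter] at hF
      simp only [← hF.2, sdiff_union_inter]
    · rw [mem_coe, mem_extensions] at hG
      exact union_inter_eq_right hRt hG.1.1
  · intro F hF
    simp only [mem_coe, mem_filter] at hF
    simp only [mem_coe, mem_filter, mem_powerset]
    exact ⟨sdiff_subset_sdiff (hΔ F hF.1) le_rfl, fun i hi => by rw [hinter F i hi, hF.2 i]⟩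

lemma HasFineFVector.colexCompression {n : ℕ} {a : Fin n → ℕ} {Δ : Finset (Finset ℕ)}
    {V : Fin n → Finset ℕ} {f : (Fin n → ℕ) → ℤ} (hV : IsOrderedPartition V (vertexSet Δ))
    (hf : HasFineFVector a Δ V f) (t : Fin n) :
    HasFineFVector a (colexCompression (vertexSet Δ) (V t) Δ) V f := by
  have hVt : V t ⊆ vertexSet Δ := hV.2.2 ▸ subset_biUnion_of_mem V (mem_univ t)
  intro b hb
  rw [hf b hb, card_filter_eq_sum_card_extensions hV.2.1 t b fun F hF => subset_vertexSet hF,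
    card_filter_eq_sum_card_extensions hV.2.1 t b fun F hF => (mem_colexCompression.1 hF).1]
  congr 1
  refine sum_congr rfl fun R hR => ?_
  rw [mem_filter, mem_powerset] at hR
  exact (card_extensions_colexCompression (disjoint_of_subset_left hR.1 sdiff_disjoint)
    (hR.1.trans sdiff_subset) hVt _).symm

/-- Every face gained by compression is dominated in colex by a face that is lost. -/
lemma exists_le_of_mem_colexCompression {U W F : Finset ℕ} {Δ : Finset (Finset ℕ)} (hWU : W ⊆ U)
    (hF : F ∈ colexCompression U W Δ) (hFΔ : F ∉ Δ) :
    ∃ H ∈ Δ, H ∉ colexCompression U W Δ ∧ toColex F ≤ toColex H := by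
  have hFU := mem_colexCompression.1 hF
  have hR : Disjoint (F \ W) W := sdiff_disjoint
  have hRU : F \ W ⊆ U := sdiff_subset.trans hFU.1
  have hmem : F ∩ W ∈ extensions W (colexCompression U W Δ) (F \ W) #(F ∩ W) :=
    mem_extensions.2 ⟨⟨inter_subset_right, rfl⟩, by rwa [sdiff_union_inter]⟩
  have hnot : F ∩ W ∉ extensions W Δ (F \ W) #(F ∩ W) := fun h =>
    hFΔ (by simpa only [sdiff_union_inter] using (mem_extensions.1 h).2)
  obtain ⟨G, hG, hG'⟩ := not_subset.1 fun hsub =>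
    hnot ((eq_of_subset_of_card_le hsub
      (card_extensions_colexCompression hR hRU hWU _).le).symm ▸ hmem)
  rw [mem_extensions] at hG
  have hGc : F \ W ∪ G ∉ colexCompression U W Δ := fun h => hG' (mem_extensions.2 ⟨hG.1, h⟩)
  refine ⟨F \ W ∪ G, hG.2, hGc, ?_⟩
  rw [union_mem_colexCompression hR hG.1.1 hWU, and_iff_right hRU, hG.1.2] at hGc
  have hle : toColex (F ∩ W) ≤ toColex G := by
    by_contra hlt
    exact hGc ((colexRank_lt_colexRank hG.1.1 hG.1.2 (not_le.1 hlt)).trans hFU.2)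
  have h := Colex.toColex_sdiff_le_toColex_sdiff (s := F) (t := F \ W ∪ G) (u := F \ W)
    sdiff_subset subset_union_left
  refine h.1 ?_
  rwa [sdiff_sdiff_right_self, union_sdiff_cancel_left (disjoint_of_subset_right hG.1.1 hR)]

/-- A face family viewed as a finite set of colex-ordered faces, itself ordered by colex. -/
def familyColex (Δ : Finset (Finset ℕ)) : Colex (Finset (Colex (Finset ℕ))) :=
  toColex (Δ.map toColex.toEmbedding)

lemma familyColex_injective : Function.Injective familyColex :=
  toColex.injective.comp (map_injective _)

lemma familyColex_colexCompression_le {U W : Finset ℕ} (Δ : Finset (Finset ℕ)) (hWU : W ⊆ U) :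
    familyColex (colexCompression U W Δ) ≤ familyColex Δ := by
  rw [familyColex, familyColex, Colex.toColex_le_toColex]
  intro F hF hFΔ
  obtain ⟨F, hFc, rfl⟩ := mem_map.1 hF
  obtain ⟨H, hH, hHc, hle⟩ := exists_le_of_mem_colexCompression hWU hFc
    fun h => hFΔ (mem_map_of_mem _ h)
  exact ⟨_, mem_map_of_mem _ hH, fun h => hHc ((mem_map' _).1 h), hle⟩

lemma toColex_le_toColex_of_colexLE {G H : Finset ℕ} (h : colexLE G H) :
    toColex G ≤ toColex H := by
  rcases h with rfl | ⟨k, hkH, hkG, hk⟩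
  · exact le_rfl
  · refine Colex.toColex_le_toColex.2 fun x hxG hxH => ⟨k, hkH, hkG, ?_⟩
    by_contra hlt
    exact hxH ((hk x (not_le.1 hlt)).1 hxG)

lemma isColorCompressedComplex_of_colexCompression_eq {n : ℕ} {a : Fin n → ℕ}
    {Δ : Finset (Finset ℕ)} {V : Fin n → Finset ℕ} (h : IsColoredComplex a Δ V)
    (hfix : ∀ t, colexCompression (vertexSet Δ) (V t) Δ = Δ) : IsColorCompressedComplex Δ V := by
  intro F hF t G hG hcard hle
  have hVt : V t ⊆ vertexSet Δ := h.2.1.2.2 ▸ subset_biUnion_of_mem V (mem_univ t)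
  rw [← hfix t, mem_colexCompression] at hF
  rw [← hfix t, union_mem_colexCompression sdiff_disjoint hG hVt, hcard]
  refine ⟨sdiff_subset.trans hF.1, lt_of_le_of_lt ?_ hF.2⟩
  rcases (toColex_le_toColex_of_colexLE hle).eq_or_lt with heq | hlt
  · rw [toColex_inj.1 heq]
  · exact (colexRank_lt_colexRank hG hcard hlt).le

/-- An array of integers is the fine f-vector of a colored
complex of type `a` iff it is the fine f-vector of a color-compressed colored
complex of type `a`. -/
theorem fineFVector_iff_colorCompressedComplex {n : ℕ} (hn : 0 < n)
    (a : Fin n → ℕ) (ha : ∀ i, 0 < a i) (f : (Fin n → ℕ) → ℤ) :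
    (∃ (Δ : Finset (Finset ℕ)) (V : Fin n → Finset ℕ),
        IsColoredComplex a Δ V ∧ HasFineFVector a Δ V f) ↔
      (∃ (Δ : Finset (Finset ℕ)) (V : Fin n → Finset ℕ),
        IsColoredComplex a Δ V ∧ IsColorCompressedComplex Δ V ∧
          HasFineFVector a Δ V f) := by
  constructor
  · rintro ⟨Δ₀, V, hΔ₀, hf₀⟩
    set S : Set (Finset (Finset ℕ)) := {Δ | IsColoredComplex a Δ V ∧ HasFineFVector a Δ V f}
    have hfin : S.Finite := by
      refine (univ.biUnion V).powerset.powerset.finite_toSet.subset fun Δ hΔ => ?_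
      rw [mem_coe, mem_powerset, hΔ.1.2.1.2.2]
      exact fun F hF => mem_powerset.2 (subset_vertexSet hF)
    obtain ⟨Δ, hΔ, hmin⟩ := hfin.exists_minimalFor familyColex S ⟨Δ₀, hΔ₀, hf₀⟩
    refine ⟨Δ, V, hΔ.1, isColorCompressedComplex_of_colexCompression_eq hΔ.1 fun t => ?_, hΔ.2⟩
    have hVt : V t ⊆ vertexSet Δ := hΔ.1.2.1.2.2 ▸ subset_biUnion_of_mem V (mem_univ t)
    have hle := familyColex_colexCompression_le Δ hVt
    exact familyColex_injective (hle.antisymm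
      (hmin ⟨hΔ.1.colexCompression t, hΔ.2.colexCompression hΔ.1.2.1 t⟩ hle))
  · rintro ⟨Δ, V, hΔ, -, hf⟩
    exact ⟨Δ, V, hΔ, hf⟩
end
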